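/- arXiv:math/0504230 — 3 statements merged into one kernel-verified Lean document; each statement's English description precedes it below -/
import Mathlib

section
/- Let P ⊆ ℝ^d be a rational d-polytope with denominator p, and for integers t ≥ 1 let L_P(t) = #(tP ∩ ℤ^d). Then there exist polynomials q_0, …, q_{p−1} ∈ ℚ[T], the maximum of whose degrees is d, such that L_P(t) = q_{t mod p}(t) for every integer t ≥ 1; that is, L_P is a quasi-polynomial of degree d whose period divides the denominator of P. -/
open Set Polynomial Pointwise

noncomputable section

/-- The integer lattice `ℤ^d` inside `ℝ^d`. -/
def lattice (d : ℕ) : Set (Fin d → ℝ) := {x | ∀ i, ∃ n : ℤ, x i = (n : ℝ)}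

/-- The residue of an integer `t` modulo a positive integer `p`, as an element of `Fin p`. -/
def resMod (p : ℕ) (hp : 0 < p) (t : ℤ) : Fin p :=
  ⟨(t % (p : ℤ)).toNat, by
    have h1 : 0 ≤ t % (p : ℤ) := Int.emod_nonneg t (by exact_mod_cast hp.ne')
    have h2 : t % (p : ℤ) < (p : ℤ) := Int.emod_lt_of_pos t (by exact_mod_cast hp)
    omega⟩

open Filter Topology MeasureTheory

/-- An integer combination of indicators of nonempty compact intervals that vanishes identically
has coefficient sum zero. -/
theorem sum_eq_zero_of_sum_indicator_Icc {ι : Type*} (J : Finset ι) (a : ι → ℤ) (l r : ι → ℝ)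
    (hlr : ∀ j ∈ J, l j ≤ r j)
    (h : ∀ c, ∑ j ∈ J, (if l j ≤ c ∧ c ≤ r j then a j else 0) = 0) :
    ∑ j ∈ J, a j = 0 := by
  classical
  rw [← Finset.sum_fiberwise_of_maps_to (t := J.image r) (g := r)
    (fun j hj => Finset.mem_image_of_mem r hj)]
  refine Finset.sum_eq_zero fun c _ => ?_
  have hev : ∀ᶠ e in 𝓝[>] c, ∀ j ∈ J,
      ((l j ≤ e ∧ e ≤ r j) ↔ (l j ≤ c ∧ c < r j)) := by
    rw [Filter.eventually_all_finset]
    intro j hj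
    have hgt : ∀ᶠ e in 𝓝[>] c, c < e := self_mem_nhdsWithin
    have hl : ∀ᶠ e in 𝓝[>] c, c < l j → e < l j := by
      by_cases hc : c < l j
      · filter_upwards [(Iio_mem_nhds hc : _ ∈ 𝓝 c) |> mem_nhdsWithin_of_mem_nhds] with e he _
        exact he
      · exact Eventually.of_forall fun e h' => absurd h' hc
    have hr : ∀ᶠ e in 𝓝[>] c, c < r j → e < r j := by
      by_cases hc : c < r j
      · filter_upwards [(Iio_mem_nhds hc : _ ∈ 𝓝 c) |> mem_nhdsWithin_of_mem_nhds] with e he _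
        exact he
      · exact Eventually.of_forall fun e h' => absurd h' hc
    filter_upwards [hgt, hl, hr] with e h1 h2 h3
    constructor
    · rintro ⟨h4, h5⟩
      exact ⟨not_lt.1 fun h6 => absurd (h2 h6) (not_lt.2 h4), h1.trans_le h5⟩
    · rintro ⟨h4, h5⟩
      exact ⟨h4.trans h1.le, (h3 h5).le⟩
  obtain ⟨e, he⟩ := hev.exists
  have h1 := h c
  have h2 := h e
  have h3 : ∑ j ∈ J, (if l j ≤ e ∧ e ≤ r j then a j else 0)
      = ∑ j ∈ J, (if l j ≤ c ∧ c < r j then a j else 0) :=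
    Finset.sum_congr rfl fun j hj => by simp only [he j hj]
  have h4 : ∑ j ∈ J, (if r j = c then a j else 0)
      = ∑ j ∈ J, (if l j ≤ c ∧ c ≤ r j then a j else 0)
        - ∑ j ∈ J, (if l j ≤ c ∧ c < r j then a j else 0) := by
    rw [← Finset.sum_sub_distrib]
    refine Finset.sum_congr rfl fun j hj => ?_
    have := hlr j hj
    rcases lt_trichotomy (r j) c with h' | h' | h'
    · simp [h'.ne, h'.not_ge, h'.not_gt]
    · subst h'; simp [this]
    · simp [h'.ne', h'.le, h']
  rw [Finset.sum_filter, h4, ← h3, h1, h2, sub_zero]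

/-- The Euler characteristic is well defined: an integer combination of indicators of compact
convex sets that vanishes identically has coefficient sum zero over the nonempty sets. -/
theorem sum_nonempty_eq_zero_of_sum_indicator (n : ℕ) {ι : Type*} (J : Finset ι) (a : ι → ℤ)
    (K : ι → Set (Fin n → ℝ)) (hcomp : ∀ j ∈ J, IsCompact (K j)) (hconv : ∀ j ∈ J, Convex ℝ (K j))
    (h : ∀ x, ∑ j ∈ J, (open Classical in if x ∈ K j then a j else 0) = 0) :
    ∑ j ∈ J, (open Classical in if (K j).Nonempty then a j else 0) = 0 := by
  classical
  induction n with
  | zero =>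
    refine Eq.trans (Finset.sum_congr rfl fun j _ => ?_) (h 0)
    refine if_congr ⟨?_, fun hx => ⟨_, hx⟩⟩ rfl rfl
    rintro ⟨x, hx⟩
    rwa [Subsingleton.elim 0 x]
  | succ n ih =>
    let slice : ℝ → ι → Set (Fin n → ℝ) := fun c j => {y | (Fin.cons c y : Fin (n + 1) → ℝ) ∈ K j}
    have hcont : ∀ c : ℝ, Continuous fun y : Fin n → ℝ => (Fin.cons c y : Fin (n + 1) → ℝ) := by
      intro c
      exact continuous_const.finCons continuous_id
    have hslice : ∀ c, ∑ j ∈ J, (if (slice c j).Nonempty then a j else 0) = 0 := by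
      intro c
      refine ih (slice c) (fun j hj => ?_) (fun j hj => ?_) (fun y => h (Fin.cons c y))
      · have : slice c j ⊆ (fun x : Fin (n + 1) → ℝ => fun i : Fin n => x i.succ) '' K j := by
          intro y hy
          exact ⟨_, hy, by ext i; simp⟩
        refine IsCompact.of_isClosed_subset ((hcomp j hj).image (by fun_prop)) ?_ this
        exact (hcomp j hj).isClosed.preimage (hcont c)
      · intro y hy z hz s t hs ht hst
        have := hconv j hj hy hz hs ht hst
        change Fin.cons c (s • y + t • z) ∈ K j
        convert this using 1
        ext i
        refine Fin.cases ?_ (fun i => ?_) i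
        · simp [← add_mul, hst]
        · simp
    have hproj : ∀ j ∈ J, (K j).Nonempty → ∃ l r : ℝ, l ≤ r ∧
        ∀ c, (slice c j).Nonempty ↔ l ≤ c ∧ c ≤ r := by
      intro j hj hne
      let I : Set ℝ := (fun x : Fin (n + 1) → ℝ => x 0) '' K j
      have hI : IsCompact I := (hcomp j hj).image (by fun_prop)
      have hIne : I.Nonempty := hne.image _
      have hIc : Convex ℝ I :=
        (hconv j hj).linear_image (LinearMap.proj (R := ℝ) (φ := fun _ : Fin (n + 1) => ℝ) 0)
      have hIcc := eq_Icc_of_connected_compact ⟨hIne, hIc.isPreconnected⟩ hI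
      refine ⟨sInf I, sSup I, ?_, fun c => ?_⟩
      · rw [← nonempty_Icc, ← hIcc]
        exact hIne
      · rw [← mem_Icc, ← hIcc]
        constructor
        · rintro ⟨y, hy⟩
          exact ⟨_, hy, rfl⟩
        · rintro ⟨x, hx, rfl⟩
          refine ⟨fun i => x i.succ, ?_⟩
          change Fin.cons (x 0) (Fin.tail x) ∈ K j
          rwa [Fin.cons_self_tail]
    choose! l r hlr hlr' using hproj
    rw [← Finset.sum_filter]
    refine sum_eq_zero_of_sum_indicator_Icc _ a l r
      (fun j hj => hlr j (Finset.mem_filter.1 hj).1 (Finset.mem_filter.1 hj).2) fun c => ?_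
    rw [Finset.sum_filter]
    refine Eq.trans (Finset.sum_congr rfl fun j hj => ?_) (hslice c)
    by_cases hne : (K j).Nonempty
    · simp only [hne, if_true, hlr' j hj hne c]
    · have : ¬ (slice c j).Nonempty := fun ⟨y, hy⟩ => hne ⟨_, hy⟩
      simp only [hne, this, if_false]

/-- Euler characteristic of a cover of a compact convex set by closed convex sets. -/
theorem sum_neg_one_pow_nonempty_inter_eq_zero {n m : ℕ} (K : Set (Fin n → ℝ))
    (hK : IsCompact K) (hKc : Convex ℝ K) (C : Fin m → Set (Fin n → ℝ))
    (hC : ∀ i, IsClosed (C i)) (hCc : ∀ i, Convex ℝ (C i)) (hcov : K ⊆ ⋃ i, C i) :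
    ∑ S : Finset (Fin m),
      (open Classical in if (K ∩ ⋂ i ∈ S, C i).Nonempty then (-1 : ℤ) ^ S.card else 0) = 0 := by
  classical
  refine sum_nonempty_eq_zero_of_sum_indicator n Finset.univ
    (fun S : Finset (Fin m) => (-1 : ℤ) ^ S.card)
    (fun S => K ∩ ⋂ i ∈ S, C i)
    (fun S _ => hK.inter_right (isClosed_biInter fun i _ => hC i))
    (fun S _ => hKc.inter (convex_iInter₂ fun i _ => hCc i)) fun x => ?_
  by_cases hx : x ∈ K
  · obtain ⟨i, hi⟩ := mem_iUnion.1 (hcov hx)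
    have hne : (Finset.univ.filter fun i => x ∈ C i).Nonempty := ⟨i, by simpa using hi⟩
    have hiff : ∀ S : Finset (Fin m), x ∈ K ∩ ⋂ i ∈ S, C i ↔
        S ∈ (Finset.univ.filter fun i => x ∈ C i).powerset := fun S => by
      simp [hx, Finset.subset_iff]
    simp only [hiff]
    rw [Finset.sum_ite_mem, Finset.univ_inter,
      Finset.sum_powerset_neg_one_pow_card_of_nonempty hne]
  · simp [hx]

theorem mem_smul_convexHull_range_iff {E : Type*} [AddCommGroup E] [Module ℝ E] {n : ℕ}
    (u : Fin n → E) {s : ℝ} (hs : 0 < s) (y : E) :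
    y ∈ s • convexHull ℝ (range u) ↔
      ∃ w : Fin n → ℝ, (∀ i, 0 ≤ w i) ∧ ∑ i, w i = s ∧ ∑ i, w i • u i = y := by
  have himg : convexHull ℝ (range u) = Fintype.linearCombination ℝ u '' stdSimplex ℝ (Fin n) := by
    rw [← convexHull_basis_eq_stdSimplex, LinearMap.image_convexHull, ← range_comp]
    congr 2
    ext i
    simp [Fintype.linearCombination_apply]
  rw [himg, mem_smul_set]
  constructor
  · rintro ⟨_, ⟨w, ⟨hw, hw1⟩, rfl⟩, rfl⟩
    refine ⟨s • w, fun i => mul_nonneg hs.le (hw i), ?_, ?_⟩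
    · simp [← Finset.mul_sum, hw1]
    · simp [Fintype.linearCombination_apply, Finset.smul_sum, mul_smul]
  · rintro ⟨w, hw, hw1, rfl⟩
    refine ⟨_, ⟨s⁻¹ • w, ⟨fun i => mul_nonneg (inv_nonneg.2 hs.le) (hw i), ?_⟩, rfl⟩, ?_⟩
    · simp [← Finset.mul_sum, hw1, hs.ne']
    · simp [Fintype.linearCombination_apply, Finset.smul_sum, hs.ne', smul_smul]

/-- The relation `∏ᵢ ([pP] - [p uᵢ]) * [tP] = 0` between indicators of Minkowski sums, where
`P` is the convex hull of the points `uᵢ`. -/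
theorem sum_neg_one_pow_mem_smul_convexHull_eq_zero {E : Type*} [AddCommGroup E] [Module ℝ E]
    [TopologicalSpace E] [IsTopologicalAddGroup E] [ContinuousSMul ℝ E] [T1Space E] {n : ℕ}
    (u : Fin n → E) {p t : ℝ} (hp : 0 ≤ p) (ht : 0 < t) (x : E) :
    ∑ S : Finset (Fin n), (open Classical in
      if x - ∑ i ∈ S, p • u i ∈ (t + p * (n - S.card : ℕ)) • convexHull ℝ (range u)
      then (-1 : ℤ) ^ S.card else 0) = 0 := by
  classical
  let K : Set (Fin n → ℝ) :=
    {w | (∀ i, 0 ≤ w i) ∧ ∑ i, w i = t + p * n ∧ ∑ i, w i • u i = x}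
  have hK : IsCompact K := by
    refine IsCompact.of_isClosed_subset (isCompact_Icc (a := (0 : Fin n → ℝ))
      (b := fun _ => t + p * n)) ?_ ?_
    · refine IsClosed.inter ?_ (IsClosed.inter ?_ ?_)
      · exact isClosed_Ici (a := (0 : Fin n → ℝ))
      · exact isClosed_eq (by fun_prop) continuous_const
      · exact isClosed_singleton.preimage (f := fun w : Fin n → ℝ => ∑ i, w i • u i) (by fun_prop)
    · rintro w ⟨h0, h1, -⟩
      refine ⟨h0, fun i => ?_⟩
      rw [← h1]
      exact Finset.single_le_sum (fun j _ => h0 j) (Finset.mem_univ i)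
  have hKc : Convex ℝ K := by
    rintro w ⟨h0, h1, h2⟩ z ⟨g0, g1, g2⟩ a b ha hb hab
    refine ⟨fun i => ?_, ?_, ?_⟩
    · exact add_nonneg (mul_nonneg ha (h0 i)) (mul_nonneg hb (g0 i))
    · simp only [Pi.add_apply, Pi.smul_apply, smul_eq_mul, Finset.sum_add_distrib,
        ← Finset.mul_sum, h1, g1]
      rw [← add_mul, hab, one_mul]
    · simp only [Pi.add_apply, Pi.smul_apply, smul_eq_mul, add_smul, mul_smul,
        Finset.sum_add_distrib, ← Finset.smul_sum, h2, g2]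
      rw [← add_smul, hab, one_smul]
  have key := sum_neg_one_pow_nonempty_inter_eq_zero K hK hKc (fun i : Fin n => {w | p ≤ w i})
    (fun i => isClosed_le continuous_const (continuous_apply i))
    (fun i => convex_halfSpace_ge (LinearMap.proj (R := ℝ) (φ := fun _ : Fin n => ℝ) i).isLinear p)
    (by
      rintro w ⟨-, h1, -⟩
      by_contra hw
      simp only [mem_iUnion, not_exists, mem_ofPred_eq, not_le] at hw
      have := Finset.sum_le_sum fun i (_ : i ∈ Finset.univ) => (hw i).le
      simp only [h1, Finset.sum_const, Finset.card_univ, Fintype.card_fin, nsmul_eq_mul] at this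
      linarith [mul_comm p (n : ℝ)])
  refine Eq.trans (Finset.sum_congr rfl fun S _ => if_congr ?_ rfl rfl) key
  have hSn : S.card ≤ n := by simpa using S.card_le_univ
  have hpos : 0 < t + p * (n - S.card : ℕ) := by positivity
  rw [mem_smul_convexHull_range_iff u hpos]
  let e : Fin n → ℝ := fun i => if i ∈ S then p else 0
  have he1 : ∑ i, e i = p * S.card := by simp [e, mul_comm]
  have he2 : ∑ i, e i • u i = ∑ i ∈ S, p • u i := by simp [e, ite_smul]
  have he0 : ∀ i, 0 ≤ e i := fun i => by simp only [e]; split_ifs <;> simp [hp]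
  constructor
  · rintro ⟨w, h0, h1, h2⟩
    refine ⟨w + e, ⟨fun i => add_nonneg (h0 i) (he0 i), ?_, ?_⟩, ?_⟩
    · simp only [Pi.add_apply, Finset.sum_add_distrib, h1, he1]
      push_cast [hSn]
      ring
    · simp only [Pi.add_apply, add_smul, Finset.sum_add_distrib, h2, he2]
      abel
    · simp only [mem_iInter, mem_ofPred_eq]
      intro i hi
      simp [e, hi, h0 i]
  · rintro ⟨w, ⟨h0, h1, h2⟩, h3⟩
    simp only [mem_iInter, mem_ofPred_eq] at h3
    refine ⟨w - e, fun i => ?_, ?_, ?_⟩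
    · by_cases hi : i ∈ S
      · simpa [e, hi] using h3 i hi
      · simpa [e, hi] using h0 i
    · simp only [Pi.sub_apply, Finset.sum_sub_distrib, h1, he1]
      push_cast [hSn]
      ring
    · simp only [Pi.sub_apply, sub_smul, Finset.sum_sub_distrib, h2, he2]

theorem add_mem_lattice_iff {d : ℕ} {x w : Fin d → ℝ} (hw : w ∈ lattice d) :
    x + w ∈ lattice d ↔ x ∈ lattice d := by
  refine forall_congr' fun i => ?_
  obtain ⟨m, hm⟩ := hw i
  constructor
  · rintro ⟨k, hk⟩
    refine ⟨k - m, ?_⟩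
    rw [Pi.add_apply] at hk
    push_cast
    linarith
  · rintro ⟨k, hk⟩
    exact ⟨k + m, by simp [hk, hm]⟩

theorem sum_mem_lattice {d : ℕ} {ι : Type*} (S : Finset ι) (w : ι → Fin d → ℝ)
    (hw : ∀ i ∈ S, w i ∈ lattice d) : ∑ i ∈ S, w i ∈ lattice d := by
  classical
  induction S using Finset.induction_on with
  | empty => exact fun i => ⟨0, by simp⟩
  | insert a S ha ih =>
    rw [Finset.sum_insert ha,
      add_mem_lattice_iff (ih fun i hi => hw i (Finset.mem_insert_of_mem hi))]
    exact hw a (Finset.mem_insert_self a S)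

theorem finite_inter_lattice {d : ℕ} {A : Set (Fin d → ℝ)} (hA : Bornology.IsBounded A) :
    (A ∩ lattice d).Finite := by
  obtain ⟨R, hR⟩ := hA.exists_norm_le
  refine Set.Finite.subset ((Set.finite_Icc (fun _ : Fin d => -⌈R⌉) fun _ => ⌈R⌉).image
    fun z i => (z i : ℝ)) ?_
  rintro x ⟨hxA, hx⟩
  choose z hz using hx
  have hb : ∀ i, |(z i : ℝ)| ≤ ⌈R⌉ := fun i => by
    rw [← hz i]
    exact ((norm_le_pi_norm x i).trans (hR x hxA)).trans (Int.le_ceil R)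
  refine ⟨z, ⟨fun i => ?_, fun i => ?_⟩, ?_⟩
  · exact_mod_cast (abs_le.1 (hb i)).1
  · exact_mod_cast (abs_le.1 (hb i)).2
  · ext i
    exact (hz i).symm

/-- The alternating sum of lattice-point counts with step `p` vanishes. -/
theorem sum_neg_one_pow_ncard_eq_zero {d n : ℕ} (u : Fin n → Fin d → ℝ) (p : ℕ)
    (hu : ∀ i, (p : ℝ) • u i ∈ lattice d) {t : ℕ} (ht : 0 < t) :
    ∑ S : Finset (Fin n), (-1 : ℤ) ^ S.card *
      ((((t + (n - S.card) * p : ℕ) : ℝ) • convexHull ℝ (range u)) ∩ lattice d).ncard = 0 := by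
  classical
  let W : Finset (Fin n) → Fin d → ℝ := fun S => ∑ i ∈ S, (p : ℝ) • u i
  have hW : ∀ S, W S ∈ lattice d := fun S => sum_mem_lattice S _ fun i _ => hu i
  let D : Finset (Fin n) → Set (Fin d → ℝ) := fun S =>
    ((t + (n - S.card) * p : ℕ) : ℝ) • convexHull ℝ (range u)
  have hfin : ∀ S, (D S ∩ lattice d).Finite := fun S =>
    finite_inter_lattice (((isBounded_convexHull.2 (finite_range u).isBounded)).smul₀ _)
  let B : Finset (Fin n) → Finset (Fin d → ℝ) := fun S => (hfin S).toFinset.image (· + W S)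
  have hB : ∀ S, (B S).card = (D S ∩ lattice d).ncard := fun S => by
    rw [Finset.card_image_of_injective _ (add_left_injective _),
      Set.ncard_eq_toFinset_card _ (hfin S)]
  let U := Finset.univ.biUnion B
  have hmem : ∀ S, ∀ x ∈ U, x ∈ B S ↔ x - W S ∈ D S := by
    intro S x hx
    obtain ⟨T, -, hT⟩ := Finset.mem_biUnion.1 hx
    obtain ⟨y, hy, rfl⟩ := Finset.mem_image.1 hT
    have hy' := (add_mem_lattice_iff (hW T)).2 ((hfin T).mem_toFinset.1 hy).2
    simp only [B, Finset.mem_image, (hfin S).mem_toFinset]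
    constructor
    · rintro ⟨z, hz, hzy⟩
      simpa [← hzy] using hz.1
    · intro h
      refine ⟨_, ⟨h, ?_⟩, sub_add_cancel _ _⟩
      rwa [← add_mem_lattice_iff (hW S), sub_add_cancel]
  calc _ = ∑ S : Finset (Fin n), ∑ x ∈ U, (if x - W S ∈ D S then (-1 : ℤ) ^ S.card else 0) := by
        refine Finset.sum_congr rfl fun S _ => ?_
        have hBU : U.filter (fun x => x ∈ B S) = B S := by
          rw [Finset.filter_mem_eq_inter]
          exact Finset.inter_eq_right.2 (Finset.subset_biUnion_of_mem B (Finset.mem_univ S))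
        rw [← hB, ← Finset.sum_filter, Finset.sum_const, nsmul_eq_mul, mul_comm,
          ← Finset.filter_congr (hmem S), hBU]
    _ = 0 := by
        rw [Finset.sum_comm]
        refine Finset.sum_eq_zero fun x _ => ?_
        refine Eq.trans (Finset.sum_congr rfl fun S _ => if_congr ?_ rfl rfl)
          (sum_neg_one_pow_mem_smul_convexHull_eq_zero u (Nat.cast_nonneg p)
            (Nat.cast_pos.2 ht) x)
        simp only [D, W]
        push_cast
        rw [mul_comm (p : ℝ)]

/-- A sequence whose `n`-th forward differences vanish is given by a polynomial. -/
theorem exists_polynomial_of_fwdDiff_iter_eq_zero (f : ℕ → ℚ) (n : ℕ)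
    (h : ∀ k, (fwdDiff 1)^[n] f k = 0) : ∃ g : ℚ[X], ∀ k : ℕ, f k = g.eval (k : ℚ) := by
  have hz : ∀ m, n ≤ m → (fwdDiff 1)^[m] f 0 = 0 := by
    intro m hm
    obtain ⟨j, rfl⟩ := Nat.exists_eq_add_of_le' hm
    rw [Function.iterate_add_apply, show (fwdDiff 1)^[n] f = fun _ => 0 from funext h]
    clear hm
    have : ∀ j : ℕ, (fwdDiff 1)^[j] (fun _ : ℕ => (0 : ℚ)) = fun _ => 0 := by
      intro j
      induction j with
      | zero => rfl
      | succ j ih => rw [Function.iterate_succ_apply', ih, fwdDiff_const]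
    rw [this]
  refine ⟨∑ m ∈ Finset.range n,
    C ((fwdDiff 1)^[m] f 0 / m.factorial) * descPochhammer ℚ m, fun k => ?_⟩
  have h1 := shift_eq_sum_fwdDiff_iter 1 f k 0
  simp only [smul_eq_mul, mul_one, zero_add] at h1
  have h2 : ∀ N, k ≤ N → f k = ∑ m ∈ Finset.range (N + 1), k.choose m • (fwdDiff 1)^[m] f 0 := by
    intro N hN
    rw [h1]
    refine Finset.sum_subset (Finset.range_subset_range.2 (by omega)) fun m _ hm => ?_
    rw [Nat.choose_eq_zero_of_lt (by simpa using hm), zero_smul]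
  rw [h2 (k + n) (by omega), eval_finsetSum]
  symm
  calc _ = ∑ m ∈ Finset.range n, k.choose m • (fwdDiff 1)^[m] f 0 := by
        refine Finset.sum_congr rfl fun m _ => ?_
        rw [eval_mul, eval_C, nsmul_eq_mul, Nat.cast_choose_eq_descPochhammer_div]
        ring
    _ = _ := by
        refine Finset.sum_subset (Finset.range_subset_range.2 (by omega)) fun m _ hm => ?_
        rw [hz m (by simpa using hm), smul_zero]

/-- The lattice-point count along an arithmetic progression of step `p` is polynomial. -/
theorem exists_polynomial_ncard_add_mul {d n : ℕ} (u : Fin n → Fin d → ℝ) (p : ℕ)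
    (hu : ∀ i, (p : ℝ) • u i ∈ lattice d) {s : ℕ} (hs : 0 < s) :
    ∃ g : ℚ[X], ∀ k : ℕ,
      (((((s + k * p : ℕ) : ℝ) • convexHull ℝ (range u)) ∩ lattice d).ncard : ℚ)
        = g.eval (k : ℚ) := by
  refine exists_polynomial_of_fwdDiff_iter_eq_zero (fun k : ℕ =>
    (((((s + k * p : ℕ) : ℝ) • convexHull ℝ (range u)) ∩ lattice d).ncard : ℚ)) n fun k => ?_
  have h1 := sum_neg_one_pow_ncard_eq_zero u p hu (t := s + k * p) (by omega)
  rw [← Finset.powerset_univ, Finset.sum_powerset_apply_card (fun m => (-1 : ℤ) ^ m *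
      ((((s + k * p + (n - m) * p : ℕ) : ℝ) • convexHull ℝ (range u)) ∩ lattice d).ncard),
    Finset.card_univ, Fintype.card_fin, ← Finset.sum_range_reflect] at h1
  have h2 := congrArg (Int.cast : ℤ → ℚ) h1
  rw [fwdDiff_iter_eq_sum_shift, ← Int.cast_zero, ← h2, Int.cast_sum]
  refine Finset.sum_congr rfl fun m hm => ?_
  have hm' : m ≤ n := by simpa [Nat.lt_succ_iff] using hm
  rw [show n + 1 - 1 - m = n - m by omega, Nat.choose_symm hm', show n - (n - m) = m by omega,
    show s + (k + m • 1) * p = s + k * p + m * p by simp; ring]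
  simp only [zsmul_eq_mul, nsmul_eq_mul]
  push_cast
  ring

theorem tendsto_ncard_div_pow {d : ℕ} {P : Set (Fin d → ℝ)} (hP : IsCompact P)
    (hc : Convex ℝ P) :
    Tendsto (fun t : ℕ => ((((t : ℝ) • P) ∩ lattice d).ncard : ℝ) / (t : ℝ) ^ d) atTop
      (𝓝 (volume.real P)) := by
  have h := tendsto_card_div_pow_atTop_volume P hP.isBounded hP.measurableSet
    (hc.addHaar_frontier volume)
  rw [Fintype.card_fin] at h
  refine h.congr' ?_
  filter_upwards [eventually_gt_atTop 0] with t ht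
  have ht0 : (t : ℝ) ≠ 0 := by positivity
  congr 2
  rw [Nat.card_coe_set_eq]
  have hL : ((Submodule.span ℤ (range (Pi.basisFun ℝ (Fin d))) : Submodule ℤ (Fin d → ℝ)) :
      Set (Fin d → ℝ)) = lattice d := by
    ext x
    rw [SetLike.mem_coe, (Pi.basisFun ℝ (Fin d)).mem_span_iff_repr_mem ℤ]
    refine forall_congr' fun i => ?_
    simp [eq_comm]
  rw [hL, ← Set.ncard_image_of_injective _ (smul_right_injective (Fin d → ℝ) ht0),
    Set.image_inter (smul_right_injective (Fin d → ℝ) ht0)]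
  simp only [image_smul, smul_inv_smul₀ ht0]

/-- A real polynomial with `Q(s) / s ^ d` tending to a nonzero limit along a sequence going to
infinity has degree `d`. -/
theorem degree_eq_of_tendsto_eval_div_pow (Q : ℝ[X]) (d : ℕ) (s : ℕ → ℝ)
    (hs : Tendsto s atTop atTop) {v : ℝ} (hv : v ≠ 0)
    (h : Tendsto (fun k => Q.eval (s k) / s k ^ d) atTop (𝓝 v)) : Q.degree = d := by
  have hX : ∀ x : ℝ, eval x (X ^ d : ℝ[X]) = x ^ d := by simp
  rcases lt_trichotomy Q.degree (X ^ d : ℝ[X]).degree with h1 | h1 | h1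
  · have := (div_tendsto_atTop_zero_of_degree_lt _ _ h1).comp hs
    simp only [Function.comp_def, hX] at this
    exact absurd (tendsto_nhds_unique h this) hv
  · rw [h1, degree_X_pow]
  · have := (abs_div_tendsto_atTop_atTop_of_degree_gt _ _ h1 ((monic_X_pow d).ne_zero)).comp hs
    simp only [Function.comp_def, hX] at this
    exact absurd h.abs (not_tendsto_nhds_of_tendsto_atTop this _)

/-- **Ehrhart's theorem.**  For a rational `d`-polytope `P` with denominator `p`,
the lattice-point counting function `L_P(t) = #(tP ∩ ℤ^d)` is a quasi-polynomial of
degree `d` whose period divides `p`. -/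
theorem ehrhart_quasipolynomial
    (d : ℕ) (hd : 1 ≤ d)
    (V : Finset (Fin d → ℝ)) (P : Set (Fin d → ℝ))
    -- `P` is the convex hull of the finite set `V` of rational points
    (hP : P = convexHull ℝ (V : Set (Fin d → ℝ)))
    (hrat : ∀ v ∈ V, ∀ i, ∃ q : ℚ, v i = (q : ℝ))
    -- `V` is exactly the vertex set of `P`
    (hvert : (V : Set (Fin d → ℝ)) = Set.extremePoints ℝ P)
    -- `P` is full-dimensional
    (hint : (interior P).Nonempty)
    -- `p` is the denominator of `P`
    (p : ℕ) (hp : 0 < p)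
    (hpV : ∀ v ∈ V, ∀ i, ∃ n : ℤ, (p : ℝ) * v i = (n : ℝ))
    (hpmin : ∀ q : ℕ, 0 < q → (∀ v ∈ V, ∀ i, ∃ n : ℤ, (q : ℝ) * v i = (n : ℝ)) → p ≤ q) :
    ∃ q : Fin p → Polynomial ℚ,
      ((∀ i, (q i).degree ≤ (d : ℕ)) ∧ (∃ i, (q i).degree = (d : ℕ))) ∧
      ∀ t : ℕ, 1 ≤ t →
        (((((t : ℝ)) • P) ∩ lattice d).ncard : ℚ)
          = (q (resMod p hp (t : ℤ))).eval (t : ℚ) := by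
  classical
  obtain ⟨u, hu⟩ : ∃ u : Fin V.card → Fin d → ℝ, range u = (V : Set (Fin d → ℝ)) :=
    ⟨fun i => (V.equivFin.symm i : Fin d → ℝ), by
      rw [range_comp' Subtype.val V.equivFin.symm, V.equivFin.symm.surjective.range_eq]
      simp⟩
  have huV : ∀ i, (p : ℝ) • u i ∈ lattice d := fun i =>
    hpV (u i) (by rw [← Finset.mem_coe, ← hu]; exact mem_range_self i)
  rw [← hu] at hP
  have hcomp : IsCompact P := by
    rw [hP]
    exact (finite_range u).isCompact_convexHull ℝ
  have hconv : Convex ℝ P := hP ▸ convex_convexHull ℝ _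
  have hvol : volume.real P ≠ 0 :=
    (ENNReal.toReal_pos (Measure.measure_pos_of_nonempty_interior volume hint).ne'
      hcomp.measure_lt_top.ne).ne'
  have hex : ∀ i : Fin p, ∃ q : ℚ[X], q.degree = d ∧ ∀ t : ℕ, 1 ≤ t → t % p = i →
      ((((t : ℝ) • P) ∩ lattice d).ncard : ℚ) = q.eval (t : ℚ) := by
    intro i
    obtain ⟨s, hs, hsp, hsi⟩ : ∃ s : ℕ, 0 < s ∧ s ≤ p ∧ s % p = i := by
      rcases Nat.eq_zero_or_pos (i : ℕ) with h0 | h0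
      · exact ⟨p, hp, le_rfl, by simp [h0]⟩
      · exact ⟨i, h0, i.2.le, Nat.mod_eq_of_lt i.2⟩
    obtain ⟨g, hg⟩ := exists_polynomial_ncard_add_mul u p huV hs
    rw [← hP] at hg
    have hp0 : (p : ℚ) ≠ 0 := by positivity
    let q : ℚ[X] := g.comp (C (p : ℚ)⁻¹ * (X - C (s : ℚ)))
    have hq : ∀ k : ℕ, (((((s + k * p : ℕ) : ℝ) • P) ∩ lattice d).ncard : ℚ)
        = q.eval ((s + k * p : ℕ) : ℚ) := by
      intro k
      rw [hg]
      simp only [q, eval_comp, eval_mul, eval_C, eval_sub, eval_X]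
      congr 1
      push_cast
      field_simp
      ring
    refine ⟨q, ?_, fun t ht hti => ?_⟩
    · have htend : Tendsto (fun k : ℕ => s + k * p) atTop atTop :=
        tendsto_atTop_mono (fun k => (Nat.le_mul_of_pos_right k hp).trans (Nat.le_add_left _ s))
          tendsto_id
      have hlim := (tendsto_ncard_div_pow hcomp hconv).comp htend
      rw [← degree_map q (algebraMap ℚ ℝ)]
      refine degree_eq_of_tendsto_eval_div_pow _ d (fun k : ℕ => ((s + k * p : ℕ) : ℝ))
        (tendsto_natCast_atTop_atTop.comp htend) hvol (hlim.congr fun k => ?_)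
      rw [eval_natCast_map, ← hq k]
      simp
    · have hst : s ≤ t := by
        by_contra hlt
        rw [Nat.mod_eq_of_lt (by omega)] at hti
        rcases hsp.lt_or_eq with h | h
        · rw [Nat.mod_eq_of_lt h] at hsi
          omega
        · rw [h, Nat.mod_self] at hsi
          omega
      obtain ⟨k, hk⟩ := (Nat.modEq_iff_dvd' hst).1 (hsi.trans hti.symm)
      obtain rfl : t = s + k * p := by
        rw [mul_comm k, ← hk]
        omega
      exact hq k
  choose q hqd hq using hex
  refine ⟨q, ⟨fun i => (hqd i).le, ⟨0, hp⟩, hqd _⟩, fun t ht => hq _ t ht ?_⟩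
  simp only [resMod]
  omega

end
end

section
/- Let P ⊆ ℝ^d be a d-polytope all of whose vertices lie in ℤ^d, and for integers t ≥ 1 let L_P(t) = #(tP ∩ ℤ^d). Then there is a single polynomial q ∈ ℚ[T] of degree d such that L_P(t) = q(t) for every integer t ≥ 1. -/
open Set Polynomial Pointwise

noncomputable section

open Filter Topology

/-- `x` is the lexicographically least nonnegative vector in its fibre under the linear map `L`. -/
def IsLexMin {n : ℕ} {E : Type*} [AddCommGroup E] [Module ℝ E]
    (L : (Fin n → ℝ) →ₗ[ℝ] E) (x : Fin n → ℝ) : Prop :=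
  (∀ i, 0 ≤ x i) ∧ ∀ y : Fin n → ℝ, (∀ i, 0 ≤ y i) → L y = L x → toLex x ≤ toLex y

theorem IsLexMin.eq_of_map_eq {n : ℕ} {E : Type*} [AddCommGroup E] [Module ℝ E]
    {L : (Fin n → ℝ) →ₗ[ℝ] E} {x y : Fin n → ℝ} (hx : IsLexMin L x) (hy : IsLexMin L y)
    (h : L x = L y) : x = y :=
  toLex_inj.mp (le_antisymm (hx.2 y hy.1 h.symm) (hy.2 x hx.1 h))

/-- Lexicographic minimality only depends on the support, and passes to smaller supports. -/
theorem IsLexMin.of_support_subset {n : ℕ} {E : Type*} [AddCommGroup E] [Module ℝ E]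
    {L : (Fin n → ℝ) →ₗ[ℝ] E} {x y : Fin n → ℝ} (hx : IsLexMin L x) (hy : ∀ i, 0 ≤ y i)
    (hxy : ∀ i, x i = 0 → y i = 0) : IsLexMin L y := by
  refine ⟨hy, fun z hz hL => ?_⟩
  by_contra hlt
  rw [not_le] at hlt
  obtain ⟨i, hi, hi'⟩ := hlt
  have hev : ∀ᶠ ε in 𝓝[>] (0 : ℝ), ∀ j, 0 ≤ x j + ε * (z j - y j) := by
    rw [eventually_all]
    intro j
    rcases (hx.1 j).eq_or_lt with h0 | h0
    · filter_upwards [self_mem_nhdsWithin] with ε hε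
      have hε' : (0 : ℝ) < ε := hε
      rw [hxy j h0.symm, ← h0]
      have := hz j
      simp only [sub_zero, zero_add]
      positivity
    · have hc : Tendsto (fun ε : ℝ => x j + ε * (z j - y j)) (𝓝[>] 0) (𝓝 (x j)) := by
        have : ContinuousAt (fun ε : ℝ => x j + ε * (z j - y j)) 0 := by fun_prop
        simpa using this.tendsto.mono_left nhdsWithin_le_nhds
      exact (hc.eventually_const_lt h0).mono fun _ h => h.le
  obtain ⟨ε, hε, hpos⟩ := (hev.and self_mem_nhdsWithin).exists
  have hpos' : (0 : ℝ) < ε := hpos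
  refine not_lt_of_ge (hx.2 (x + ε • (z - y)) (fun j => by simpa using hε j) (by simp [hL])) ?_
  refine ⟨i, fun j hj => ?_, ?_⟩
  · have : z j = y j := hi j hj
    simp [this]
  · have : z i < y i := hi'
    change x i + ε * (z i - y i) < x i
    nlinarith

/-- A nonempty compact set has a lexicographically least element. -/
theorem IsCompact.exists_toLex_le {n : ℕ} {K : Set (Fin n → ℝ)} (hK : IsCompact K)
    (hne : K.Nonempty) : ∃ x ∈ K, ∀ y ∈ K, toLex x ≤ toLex y := by
  have key : ∀ k ≤ n, ∃ x ∈ K, ∀ y ∈ K, (∀ i : Fin n, (i : ℕ) < k → x i = y i) ∨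
      toLex x < toLex y := by
    intro k
    induction k with
    | zero =>
      intro _
      obtain ⟨x, hx⟩ := hne
      exact ⟨x, hx, fun y _ => Or.inl fun i hi => absurd hi (Nat.not_lt_zero _)⟩
    | succ k ih =>
      intro hk
      obtain ⟨x, hx, hxmin⟩ := ih (Nat.le_of_succ_le hk)
      have hclosed : IsClosed {y : Fin n → ℝ | ∀ i : Fin n, (i : ℕ) < k → x i = y i} := by
        simp only [Set.ofPred_forall]
        exact isClosed_iInter fun i => isClosed_iInter fun _ =>
          isClosed_eq continuous_const (continuous_apply i)
      obtain ⟨w, ⟨hwK, hw⟩, hwmin⟩ := (hK.inter_right hclosed).exists_isMinOn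
        ⟨x, hx, fun _ _ => rfl⟩ (continuous_apply (⟨k, hk⟩ : Fin n)).continuousOn
      refine ⟨w, hwK, fun y hy => ?_⟩
      by_cases hxy : ∀ i : Fin n, (i : ℕ) < k → x i = y i
      · have hle : w ⟨k, hk⟩ ≤ y ⟨k, hk⟩ := hwmin ⟨hy, hxy⟩
        rcases hle.eq_or_lt with h | h
        · left
          intro i hi
          rcases (Nat.lt_succ_iff.mp hi).eq_or_lt with h' | h'
          · have : i = ⟨k, hk⟩ := Fin.ext h'
            rw [this, h]
          · rw [← hw i h', hxy i h']
        · right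
          exact ⟨⟨k, hk⟩, fun j hj => (hw j hj).symm.trans (hxy j hj), h⟩
      · obtain ⟨i, hi, hlt⟩ := (hxmin y hy).resolve_left hxy
        have hik : (i : ℕ) < k := by
          by_contra hik
          exact hxy fun j hj => hi j (Fin.lt_def.mpr (lt_of_lt_of_le hj (not_lt.mp hik)))
        refine Or.inr ⟨i, fun j hj => (hw j (lt_trans hj hik)).symm.trans (hi j hj), ?_⟩
        change w i < y i
        rw [← hw i hik]
        exact hlt
  obtain ⟨x, hx, h⟩ := key n le_rfl
  refine ⟨x, hx, fun y hy => ?_⟩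
  rcases h y hy with h | h
  · exact le_of_eq (congrArg toLex (funext fun i => h i i.2))
  · exact h.le

/-- The linear map sending weights to their sum together with the weighted sum of the points. -/
def weightMap {n d : ℕ} (A : Fin n → Fin d → ℝ) :
    (Fin n → ℝ) →ₗ[ℝ] ℝ × (Fin d → ℝ) :=
  Fintype.linearCombination ℝ fun i => ((1 : ℝ), A i)

theorem weightMap_fst {n d : ℕ} (A : Fin n → Fin d → ℝ) (x : Fin n → ℝ) :
    (weightMap A x).1 = ∑ i, x i := by
  simp [weightMap, Fintype.linearCombination_apply, Prod.fst_sum]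

theorem weightMap_snd {n d : ℕ} (A : Fin n → Fin d → ℝ) (x : Fin n → ℝ) (j : Fin d) :
    (weightMap A x).2 j = ∑ i, x i * A i j := by
  simp [weightMap, Fintype.linearCombination_apply, Prod.snd_sum]

theorem exists_isLexMin_weightMap {n d : ℕ} (A : Fin n → Fin d → ℝ) {y : Fin n → ℝ}
    (hy : ∀ i, 0 ≤ y i) : ∃ x, IsLexMin (weightMap A) x ∧ weightMap A x = weightMap A y := by
  have hK : IsCompact {x : Fin n → ℝ | (∀ i, 0 ≤ x i) ∧ weightMap A x = weightMap A y} := by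
    refine (isCompact_Icc (a := (0 : Fin n → ℝ)) (b := fun _ => ∑ i, y i)).of_isClosed_subset
      ?_ ?_
    · exact isClosed_Ici.inter (isClosed_eq (weightMap A).continuous_of_finiteDimensional
        continuous_const)
    · rintro x ⟨hx, hL⟩
      refine ⟨hx, fun i => ?_⟩
      rw [← weightMap_fst A, ← hL, weightMap_fst]
      exact Finset.single_le_sum (fun j _ => hx j) (Finset.mem_univ i)
  obtain ⟨x, ⟨hx, hL⟩, hmin⟩ := hK.exists_toLex_le ⟨y, hy, rfl⟩
  exact ⟨x, ⟨hx, fun z hz hzx => hmin z ⟨hz, hzx.trans hL⟩⟩, hL⟩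

theorem mem_smul_convexHull_range_iff_s1 {n d : ℕ} (A : Fin n → Fin d → ℝ) {t : ℝ} (ht : 0 < t)
    (p : Fin d → ℝ) : p ∈ t • convexHull ℝ (Set.range A) ↔
      ∃ y : Fin n → ℝ, (∀ i, 0 ≤ y i) ∧ weightMap A y = (t, p) := by
  have hconv : convexHull ℝ (Set.range A) =
      {p | ∃ y : Fin n → ℝ, (∀ i, 0 ≤ y i) ∧ weightMap A y = (1, p)} := by
    apply Set.Subset.antisymm
    · refine convexHull_min ?_ ?_
      · rintro _ ⟨i, rfl⟩
        refine ⟨Pi.single i 1, fun j => ?_, ?_⟩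
        · by_cases h : j = i
          · subst h; simp
          · simp [h]
        · simp [weightMap, Fintype.linearCombination_apply_single]
      · rintro p ⟨y, hy, hyp⟩ q ⟨z, hz, hzq⟩ a b ha hb hab
        refine ⟨a • y + b • z, fun i => ?_, ?_⟩
        · have := hy i
          have := hz i
          simp only [Pi.add_apply, Pi.smul_apply, smul_eq_mul]
          positivity
        · simp [hyp, hzq, hab]
    · rintro p ⟨y, hy, hyp⟩
      have h1 : ∑ i, y i = 1 := by rw [← weightMap_fst A, hyp]
      have h2 : p = ∑ i, y i • A i := by
        funext j
        have := weightMap_snd A y j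
        rw [hyp] at this
        simpa using this
      rw [h2]
      exact (convex_convexHull ℝ _).sum_mem (fun i _ => hy i) h1
        fun i _ => subset_convexHull ℝ _ ⟨i, rfl⟩
  rw [hconv, Set.mem_smul_set]
  constructor
  · rintro ⟨q, ⟨y, hy, hyq⟩, rfl⟩
    exact ⟨t • y, fun i => mul_nonneg ht.le (hy i), by simp [hyq]⟩
  · rintro ⟨y, hy, hyp⟩
    refine ⟨t⁻¹ • p, ⟨t⁻¹ • y, fun i => mul_nonneg (inv_nonneg.mpr ht.le) (hy i), ?_⟩, ?_⟩
    · simp [hyp, ht.ne']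
    · rw [smul_inv_smul₀ ht.ne']

/-- Bounded sets contain finitely many lattice points. -/
theorem finite_lattice_inter_bounded (d : ℕ) (C : ℝ) :
    {p | p ∈ lattice d ∧ ∀ j, |p j| ≤ C}.Finite := by
  refine (((Set.finite_Icc (fun _ : Fin d => -⌈C⌉) fun _ => ⌈C⌉)).image
    fun (z : Fin d → ℤ) j => (z j : ℝ)).subset ?_
  rintro p ⟨hp, hC⟩
  choose z hz using hp
  refine ⟨z, ⟨fun j => ?_, fun j => ?_⟩, funext fun j => (hz j).symm⟩
  · have h := (neg_le_of_abs_le (hC j)).trans_eq (hz j)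
    have h' := Int.le_ceil C
    have : ((-⌈C⌉ : ℤ) : ℝ) ≤ z j := by push_cast; linarith
    exact_mod_cast this
  · have h := (hz j).symm.trans_le (le_of_abs_le (hC j))
    exact_mod_cast h.trans (Int.le_ceil C)

/-- The lexicographically least weights in the unit cube whose weighted sum is a lattice point:
the lattice points of the half-open fundamental parallelepipeds of a triangulation. -/
def boxWeights {n d : ℕ} (A : Fin n → Fin d → ℝ) : Set (Fin n → ℝ) :=
  {b | IsLexMin (weightMap A) b ∧ (∀ i, b i ≤ 1) ∧ (∃ k : ℕ, ∑ i, b i = k) ∧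
    (weightMap A b).2 ∈ lattice d}

theorem finite_boxWeights {n d : ℕ} (A : Fin n → Fin d → ℝ) : (boxWeights A).Finite := by
  have hinj : Set.InjOn (weightMap A) (boxWeights A) := fun x hx y hy h =>
    hx.1.eq_of_map_eq hy.1 h
  refine Set.Finite.of_finite_image (Set.Finite.subset (((Set.finite_Iic n).image
    (Nat.cast : ℕ → ℝ)).prod
      (finite_lattice_inter_bounded d (∑ j, ∑ i, |A i j|))) ?_) hinj
  rintro _ ⟨b, ⟨hb, hb1, ⟨k, hk⟩, hlat⟩, rfl⟩
  refine ⟨⟨k, ?_, ?_⟩, hlat, fun j => ?_⟩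
  · have : (k : ℝ) ≤ n := by
      rw [← hk]
      simpa using Finset.sum_le_sum fun i (_ : i ∈ Finset.univ) => hb1 i
    exact_mod_cast this
  · rw [weightMap_fst, hk]
  · rw [weightMap_snd]
    calc |∑ i, b i * A i j| ≤ ∑ i, |b i * A i j| := Finset.abs_sum_le_sum_abs _ _
      _ ≤ ∑ i, |A i j| := Finset.sum_le_sum fun i _ => by
        rw [abs_mul, abs_of_nonneg (hb.1 i)]
        exact mul_le_of_le_one_left (abs_nonneg _) (hb1 i)
      _ ≤ ∑ j, ∑ i, |A i j| := Finset.single_le_sum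
        (f := fun j => ∑ i, |A i j|) (fun j _ => Finset.sum_nonneg fun i _ => abs_nonneg _)
        (Finset.mem_univ j)

/-- The natural vectors supported on the support of `b` which bring the total weight to `t`. -/
def translations {n : ℕ} (b : Fin n → ℝ) (t : ℕ) : Finset (Fin n →₀ ℕ) :=
  if ⌊∑ i, b i⌋₊ ≤ t then
    (Finset.univ.filter fun i => b i ≠ 0).finsuppAntidiag (t - ⌊∑ i, b i⌋₊) else ∅

theorem mem_translations {n : ℕ} {b : Fin n → ℝ} {k t : ℕ} (hk : ∑ i, b i = k)
    (m : Fin n →₀ ℕ) : m ∈ translations b t ↔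
      ∑ i, (b i + m i) = t ∧ ∀ i, b i = 0 → m i = 0 := by
  have hsupp : m.support ⊆ (Finset.univ.filter fun i => b i ≠ 0) ↔
      ∀ i, b i = 0 → m i = 0 := by
    simp only [Finset.subset_iff, Finsupp.mem_support_iff, Finset.mem_filter, Finset.mem_univ,
      true_and]
    exact forall_congr' fun i => not_imp_not
  have hsum : (∑ i, (b i + m i) = t) ↔ k + ∑ i, m i = t := by
    rw [Finset.sum_add_distrib, hk]
    exact_mod_cast Iff.rfl
  rw [translations, hk, Nat.floor_natCast, hsum]
  by_cases hkt : k ≤ t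
  · rw [if_pos hkt, Finset.mem_finsuppAntidiag, hsupp]
    refine and_congr_left fun h => ?_
    have hf : ∑ i with b i ≠ 0, m i = ∑ i, m i :=
      Finset.sum_filter_of_ne fun i _ hi hb => hi (h i hb)
    rw [hf]
    omega
  · rw [if_neg hkt]
    simp only [Finset.notMem_empty, false_iff, not_and]
    omega

theorem exists_polynomial_card_translations {n : ℕ} {b : Fin n → ℝ}
    (h1 : ∀ i, b i ≤ 1) {k : ℕ} (hk : ∑ i, b i = k) :
    ∃ q : Polynomial ℚ, ∀ t : ℕ, 1 ≤ t → ((translations b t).card : ℚ) = q.eval (t : ℚ) := by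
  have hks : k ≤ (Finset.univ.filter fun i => b i ≠ 0).card := by
    have : (k : ℝ) ≤ (Finset.univ.filter fun i => b i ≠ 0).card := by
      rw [← hk, ← Finset.sum_filter_ne_zero]
      simpa using Finset.sum_le_sum fun i (_ : i ∈ Finset.univ.filter fun i => b i ≠ 0) => h1 i
    exact_mod_cast this
  obtain hs | hs := Nat.eq_zero_or_eq_succ_pred (Finset.univ.filter fun i => b i ≠ 0).card
  · refine ⟨0, fun t ht => ?_⟩
    have hk0 : k = 0 := by omega
    have : t - k ≠ 0 := by omega
    rw [translations, hk, Nat.floor_natCast, Finset.card_eq_zero.mp hs]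
    simp [Finset.finsuppAntidiag_empty_of_ne_zero this]
  · generalize (Finset.univ.filter fun i => b i ≠ 0).card.pred = s at hs
    refine ⟨preHilbertPoly ℚ s k, fun t ht => ?_⟩
    rw [translations, hk, Nat.floor_natCast]
    by_cases hkt : k ≤ t
    · rw [if_pos hkt, preHilbertPoly_eq_choose_sub_add ℚ s hkt,
        Finset.card_finsuppAntidiag_nat_eq_choose, hs, Nat.succ_eq_add_one,
        show s + 1 + (t - k) - 1 = (t - k) + s by omega, Nat.choose_symm_add]
    · rw [if_neg hkt, preHilbertPoly]
      obtain ⟨r, rfl⟩ : ∃ r, k = t + 1 + r := ⟨k - (t + 1), by omega⟩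
      have : (ascPochhammer ℚ s).eval (-(r : ℚ)) = 0 :=
        ascPochhammer_eval_neg_coe_nat_of_lt (by omega)
      have h' : (t : ℚ) - (t + 1 + r) + 1 = -r := by ring
      simp [eval_comp, h', this]

theorem add_mem_lattice {d : ℕ} {x y : Fin d → ℝ} (hx : x ∈ lattice d) (hy : y ∈ lattice d) :
    x + y ∈ lattice d := fun i => by
  obtain ⟨a, ha⟩ := hx i
  obtain ⟨b, hb⟩ := hy i
  exact ⟨a + b, by simp [ha, hb]⟩

theorem sub_mem_lattice {d : ℕ} {x y : Fin d → ℝ} (hx : x ∈ lattice d) (hy : y ∈ lattice d) :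
    x - y ∈ lattice d := fun i => by
  obtain ⟨a, ha⟩ := hx i
  obtain ⟨b, hb⟩ := hy i
  exact ⟨a - b, by simp [ha, hb]⟩

theorem weightMap_natCast_mem_lattice {n d : ℕ} {A : Fin n → Fin d → ℝ}
    (hA : ∀ i, A i ∈ lattice d) (m : Fin n → ℕ) :
    (weightMap A fun i => (m i : ℝ)).2 ∈ lattice d := fun j => by
  choose z hz using hA
  refine ⟨∑ i, m i * z i j, ?_⟩
  rw [weightMap_snd]
  simp [hz]

/-- Every lattice point of a dilate splits uniquely into box weights and a translation. -/
theorem ncard_smul_convexHull_inter_lattice {n d : ℕ} {A : Fin n → Fin d → ℝ}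
    (hA : ∀ i, A i ∈ lattice d) {t : ℕ} (ht : 1 ≤ t) :
    (((t : ℝ) • convexHull ℝ (Set.range A)) ∩ lattice d).ncard =
      ∑ b ∈ (finite_boxWeights A).toFinset, (translations b t).card := by
  classical
  have ht' : (0 : ℝ) < t := by exact_mod_cast ht
  set f : ((_ : Fin n → ℝ) × (Fin n →₀ ℕ)) → (Fin d → ℝ) :=
    fun p => (weightMap A (fun i => p.1 i + p.2 i)).2 with hf
  set S := (finite_boxWeights A).toFinset.sigma fun b => translations b t with hS
  have hmem : ∀ p ∈ S, IsLexMin (weightMap A) p.1 ∧ (∀ i, p.1 i ≤ 1) ∧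
      (weightMap A p.1).2 ∈ lattice d ∧ ∑ i, (p.1 i + p.2 i) = t ∧
      ∀ i, p.1 i = 0 → p.2 i = 0 := by
    rintro ⟨b, m⟩ hp
    obtain ⟨hb, hm⟩ := Finset.mem_sigma.mp hp
    obtain ⟨hb, hb1, ⟨k, hk⟩, hlat⟩ := (finite_boxWeights A).mem_toFinset.mp hb
    obtain ⟨h1, h2⟩ := (mem_translations hk m).mp hm
    exact ⟨hb, hb1, hlat, h1, h2⟩
  have hlex : ∀ p ∈ S, IsLexMin (weightMap A) fun i => p.1 i + p.2 i := by
    intro p hp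
    obtain ⟨hb, -, -, -, h0⟩ := hmem p hp
    refine hb.of_support_subset (fun i => add_nonneg (hb.1 i) (Nat.cast_nonneg _)) fun i hi => ?_
    simp [hi, h0 i hi]
  have himage : ((t : ℝ) • convexHull ℝ (Set.range A)) ∩ lattice d = f '' S := by
    ext p
    constructor
    · rintro ⟨hp, hlat⟩
      obtain ⟨y, hy, hyp⟩ := (mem_smul_convexHull_range_iff_s1 A ht' p).mp hp
      obtain ⟨x, hx, hxy⟩ := exists_isLexMin_weightMap A hy
      rw [hyp] at hxy
      let m : Fin n →₀ ℕ := Finsupp.equivFunOnFinite.symm fun i => ⌈x i⌉₊ - 1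
      have hm : ∀ i, m i = ⌈x i⌉₊ - 1 := fun i => rfl
      let b : Fin n → ℝ := fun i => x i - m i
      have hbm : (fun i => b i + m i) = x := funext fun i => sub_add_cancel _ _
      have hcases : ∀ i, (x i = 0 ∧ m i = 0) ∨ (0 < b i ∧ b i ≤ 1) := by
        intro i
        rcases (hx.1 i).eq_or_lt with h | h
        · left
          simp [hm, ← h]
        · right
          have hc : 1 ≤ ⌈x i⌉₊ := Nat.ceil_pos.mpr h
          have h1 := Nat.le_ceil (x i)
          have h2 := Nat.ceil_lt_add_one h.le
          have h3 : (m i : ℝ) = ⌈x i⌉₊ - 1 := by rw [hm]; push_cast [hc]; rfl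
          constructor <;> simp only [b, h3] <;> linarith
      have hb0 : ∀ i, 0 ≤ b i := fun i => by
        rcases hcases i with ⟨h, h'⟩ | h
        · simp [b, h, h']
        · exact h.1.le
      have hb1 : ∀ i, b i ≤ 1 := fun i => by
        rcases hcases i with ⟨h, h'⟩ | h
        · simp [b, h, h']
        · exact h.2
      have hbx : ∀ i, x i = 0 → b i = 0 := fun i hi => by
        simp [b, hi, hm]
      have hbm0 : ∀ i, b i = 0 → m i = 0 := fun i hi => by
        rcases hcases i with ⟨h, h'⟩ | h
        · exact h'
        · exact absurd hi h.1.ne'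
      have hxsum : ∑ i, x i = t := by rw [← weightMap_fst A, hxy]
      have hsum : ∑ i, b i + ((∑ i, m i : ℕ) : ℝ) = t := by
        rw [← hxsum, Nat.cast_sum, ← Finset.sum_add_distrib]
        exact congrArg (fun g : Fin n → ℝ => ∑ i, g i) hbm
      have hle : ∑ i, m i ≤ t := by
        have : ((∑ i, m i : ℕ) : ℝ) ≤ t := by
          rw [← hsum]
          exact le_add_of_nonneg_left (Finset.sum_nonneg fun i _ => hb0 i)
        exact_mod_cast this
      have hbsum : ∑ i, b i = ((t - ∑ i, m i : ℕ) : ℝ) := by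
        rw [Nat.cast_sub hle]
        linarith
      have hblat : (weightMap A b).2 ∈ lattice d := by
        have : b = x - fun i => (m i : ℝ) := rfl
        rw [this, map_sub, hxy]
        exact sub_mem_lattice hlat (weightMap_natCast_mem_lattice hA m)
      refine ⟨⟨b, m⟩, ?_, ?_⟩
      · rw [hS, Finset.mem_coe, Finset.mem_sigma, Set.Finite.mem_toFinset]
        refine ⟨⟨hx.of_support_subset hb0 hbx, hb1, ⟨_, hbsum⟩, hblat⟩, ?_⟩
        rw [mem_translations hbsum]
        refine ⟨?_, hbm0⟩
        rw [← hxsum]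
        exact congrArg (fun g : Fin n → ℝ => ∑ i, g i) hbm
      · change (weightMap A fun i => b i + m i).2 = p
        rw [hbm, hxy]
    · rintro ⟨q, hq, rfl⟩
      obtain ⟨hb, -, hlat, hsum, -⟩ := hmem q hq
      refine ⟨(mem_smul_convexHull_range_iff_s1 A ht' _).mpr
        ⟨_, (hlex q hq).1, Prod.ext ?_ rfl⟩, ?_⟩
      · rw [weightMap_fst, hsum]
      · have : (fun i => q.1 i + (q.2 i : ℝ)) = q.1 + fun i => (q.2 i : ℝ) := rfl
        simp only [hf]
        rw [this, map_add]
        exact add_mem_lattice hlat (weightMap_natCast_mem_lattice hA _)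
  have hinj : Set.InjOn f S := by
    rintro ⟨b, m⟩ hp ⟨b', m'⟩ hp' h
    have heq : (fun i => b i + (m i : ℝ)) = fun i => b' i + (m' i : ℝ) := by
      refine (hlex _ hp).eq_of_map_eq (hlex _ hp') (Prod.ext ?_ h)
      rw [weightMap_fst, weightMap_fst]
      exact (hmem _ hp).2.2.2.1.trans (hmem _ hp').2.2.2.1.symm
    obtain ⟨hb, hb1, -, -, hb0⟩ := hmem _ hp
    obtain ⟨hb', hb1', -, -, hb0'⟩ := hmem _ hp'
    have aux : ∀ {u v : ℝ} {k l : ℕ}, u ≤ 1 → 0 ≤ v → (v = 0 → l = 0) → u + k = v + l →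
        ¬ k < l := by
      intro u v k l hu hv hl he hlt
      have : (k : ℝ) + 1 ≤ l := by exact_mod_cast hlt
      have := hl (by linarith)
      omega
    have hmm : m = m' := by
      ext i
      have hi := congrFun heq i
      exact le_antisymm (not_lt.mp (aux (hb1' i) (hb.1 i) (hb0 i) hi.symm))
        (not_lt.mp (aux (hb1 i) (hb'.1 i) (hb0' i) hi))
    subst hmm
    have hbb : b = b' := funext fun i => add_right_cancel (congrFun heq i)
    rw [hbb]
  rw [himage, hinj.ncard_image, Set.ncard_coe_finset, Finset.card_sigma]

theorem exists_polynomial_ncard_smul_convexHull {n d : ℕ} {A : Fin n → Fin d → ℝ}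
    (hA : ∀ i, A i ∈ lattice d) : ∃ q : Polynomial ℚ, ∀ t : ℕ, 1 ≤ t →
      ((((t : ℝ) • convexHull ℝ (Set.range A)) ∩ lattice d).ncard : ℚ) = q.eval (t : ℚ) := by
  have hq : ∀ b : Fin n → ℝ, ∃ q : Polynomial ℚ, b ∈ boxWeights A → ∀ t : ℕ, 1 ≤ t →
      ((translations b t).card : ℚ) = q.eval (t : ℚ) := by
    intro b
    by_cases hb : b ∈ boxWeights A
    · obtain ⟨k, hk⟩ := hb.2.2.1
      obtain ⟨q, hq⟩ := exists_polynomial_card_translations hb.2.1 hk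
      exact ⟨q, fun _ => hq⟩
    · exact ⟨0, fun h => absurd h hb⟩
  choose q hq using hq
  refine ⟨∑ b ∈ (finite_boxWeights A).toFinset, q b, fun t ht => ?_⟩
  rw [ncard_smul_convexHull_inter_lattice hA ht, Nat.cast_sum, eval_finsetSum]
  exact Finset.sum_congr rfl fun b hb => hq b ((finite_boxWeights A).mem_toFinset.mp hb) t ht

theorem lattice_eq_span (d : ℕ) :
    lattice d = (Submodule.span ℤ (Set.range (Pi.basisFun ℝ (Fin d))) : Set (Fin d → ℝ)) := by
  ext x
  rw [SetLike.mem_coe, Module.Basis.mem_span_iff_repr_mem]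
  simp [lattice, eq_comm]

/-- The number of lattice points in the dilates of a compact convex body grows like its volume. -/
theorem tendsto_ncard_smul_inter_lattice_div_pow {d : ℕ} {P : Set (Fin d → ℝ)}
    (hP : IsCompact P) (hconv : Convex ℝ P) :
    Tendsto (fun t : ℕ => ((((t : ℝ) • P) ∩ lattice d).ncard : ℝ) / (t : ℝ) ^ d) atTop
      (𝓝 (MeasureTheory.volume.real P)) := by
  have h := tendsto_card_div_pow_atTop_volume P hP.isBounded hP.measurableSet
    (hconv.addHaar_frontier MeasureTheory.volume)
  rw [Fintype.card_fin] at h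
  refine h.congr' ?_
  filter_upwards [eventually_ge_atTop 1] with t ht
  have ht' : (t : ℝ) ≠ 0 := by positivity
  congr 2
  have hset : ((t : ℝ) • P) ∩ lattice d = (t : ℝ) • (P ∩ (t : ℝ)⁻¹ • lattice d) := by
    rw [Set.smul_set_inter₀ ht', smul_inv_smul₀ ht']
  rw [hset, ← lattice_eq_span, Nat.card_coe_set_eq]
  exact (Set.ncard_image_of_injective _ (smul_right_injective _ ht')).symm

/-- A polynomial growing like a nonzero multiple of `t ^ d` along the naturals has degree `d`. -/
theorem Polynomial.degree_eq_of_tendsto_div_pow {q : Polynomial ℝ} {d : ℕ} {c : ℝ} (hc : c ≠ 0)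
    (h : Tendsto (fun t : ℕ => q.eval (t : ℝ) / (t : ℝ) ^ d) atTop (𝓝 c)) : q.degree = d := by
  have hd : (X ^ d : Polynomial ℝ).degree = d := degree_X_pow d
  rcases lt_trichotomy q.degree d with hlt | heq | hgt
  · have h0 := (div_tendsto_atTop_zero_of_degree_lt q (X ^ d) (by rwa [hd])).comp
      tendsto_natCast_atTop_atTop
    simp only [Function.comp_def, eval_pow, eval_X] at h0
    exact absurd (tendsto_nhds_unique h h0) hc
  · exact heq
  · have h0 := (abs_div_tendsto_atTop_atTop_of_degree_gt q (X ^ d) (by rwa [hd])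
      (pow_ne_zero d X_ne_zero)).comp tendsto_natCast_atTop_atTop
    simp only [Function.comp_def, eval_pow, eval_X] at h0
    exact absurd h.abs (not_tendsto_nhds_of_tendsto_atTop h0 _)

/-- **Ehrhart's theorem for integral polytopes.**  For a `d`-polytope `P` with integer
vertices, the lattice-point counting function `L_P(t) = #(tP ∩ ℤ^d)` agrees with a single
polynomial of degree `d` at all positive integers `t`. -/
theorem ehrhart_polynomial_integral
    (d : ℕ) (hd : 1 ≤ d)
    (V : Finset (Fin d → ℝ)) (P : Set (Fin d → ℝ))
    -- `P` is the convex hull of the finite set `V`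
    (hP : P = convexHull ℝ (V : Set (Fin d → ℝ)))
    -- `V` is exactly the vertex set of `P`
    (hvert : (V : Set (Fin d → ℝ)) = Set.extremePoints ℝ P)
    -- all vertices of `P` are integral
    (hVint : ∀ v ∈ V, ∀ i, ∃ n : ℤ, v i = (n : ℝ))
    -- `P` is full-dimensional
    (hint : (interior P).Nonempty) :
    ∃ q : Polynomial ℚ, q.degree = (d : ℕ) ∧
      ∀ t : ℕ, 1 ≤ t →
        ((((t : ℝ) • P) ∩ lattice d).ncard : ℚ) = q.eval (t : ℚ) := by
  let A : Fin V.card → Fin d → ℝ := fun i => (V.equivFin.symm i : Fin d → ℝ)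
  have hrange : Set.range A = (V : Set (Fin d → ℝ)) := by
    have : A = Subtype.val ∘ V.equivFin.symm := rfl
    rw [this, V.equivFin.symm.surjective.range_comp, Subtype.range_coe]
  have hPA : P = convexHull ℝ (Set.range A) := by rw [hP, hrange]
  obtain ⟨q, hq⟩ := exists_polynomial_ncard_smul_convexHull
    (A := A) fun i => hVint _ (V.equivFin.symm i).2
  rw [← hPA] at hq
  refine ⟨q, ?_, hq⟩
  have hcomp : IsCompact P := hP ▸ V.finite_toSet.isCompact_convexHull ℝ
  have hconv : Convex ℝ P := hP ▸ convex_convexHull ℝ _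
  have hvol : MeasureTheory.volume.real P ≠ 0 := by
    rw [MeasureTheory.measureReal_ne_zero_iff hcomp.measure_lt_top.ne]
    exact (MeasureTheory.Measure.measure_pos_of_nonempty_interior _ hint).ne'
  rw [← degree_map q (algebraMap ℚ ℝ)]
  refine degree_eq_of_tendsto_div_pow hvol
    ((tendsto_ncard_smul_inter_lattice_div_pow hcomp hconv).congr' ?_)
  filter_upwards [eventually_ge_atTop 1] with t ht
  congr 1
  have h := congrArg (algebraMap ℚ ℝ) (hq t ht)
  rw [map_natCast] at h
  rw [h, eval_natCast_map]
end
end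

section
/- (Ehrhart–Macdonald reciprocity) Let P ⊆ ℝ^d be a rational d-polytope with denominator p. Set L_P(t) = #(tP ∩ ℤ^d) and L_{P°}(t) = #(tP° ∩ ℤ^d) for integers t ≥ 1, where P° is the interior of P. Then there exist polynomials q_0, …, q_{p−1} ∈ ℚ[T] such that for every integer t ≥ 1 one has L_P(t) = q_{t mod p}(t) and (−1)^d · q_{(−t) mod p}(−t) = L_{P°}(t); i.e., the Ehrhart quasi-polynomial of P evaluated at −t equals (−1)^d times the number of integer points in tP°. -/
open Set Polynomial Pointwise

noncomputable section

/-! ### Counting polynomials -/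

/-- The polynomial in `T` whose value at `T = h + p * m` is the number of `d + 1`-tuples of natural
numbers with sum `m`. -/
def dilatePoly (d p : ℕ) (h : ℤ) : ℚ[X] :=
  C ((d.factorial : ℚ)⁻¹) * (descPochhammer ℚ d).comp (C ((p : ℚ)⁻¹) * (X - C (h : ℚ)) + C (d : ℚ))

lemma dilatePoly_eval (d p : ℕ) (h : ℤ) (x : ℚ) :
    (dilatePoly d p h).eval x =
      (d.factorial : ℚ)⁻¹ * ∏ j ∈ Finset.range d, ((p : ℚ)⁻¹ * (x - h) + d - j) := by
  simp [dilatePoly, descPochhammer_eval_eq_prod_range]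

lemma dilatePoly_eval_neg (d : ℕ) {p : ℕ} (hp : 0 < p) (h : ℤ) (x : ℚ) :
    (-1 : ℚ) ^ d * (dilatePoly d p h).eval (-x) = (dilatePoly d p ((d + 1) * p - h)).eval x := by
  have hp' : (p : ℚ) ≠ 0 := by positivity
  rw [dilatePoly_eval, dilatePoly_eval, mul_left_comm]
  congr 1
  rw [← Finset.prod_range_reflect, show (-1 : ℚ) ^ d = ∏ _j ∈ Finset.range d, (-1 : ℚ) by simp,
    ← Finset.prod_mul_distrib]
  refine Finset.prod_congr rfl fun j hj => ?_
  have hj' : j + 1 ≤ d := Finset.mem_range.1 hj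
  rw [show d - 1 - j = d - (j + 1) by omega, Nat.cast_sub hj']
  push_cast
  field_simp
  ring

lemma dilatePoly_eval_of_eq (d : ℕ) {p : ℕ} (hp : 0 < p) {h t m : ℤ} (htm : t = h + p * m)
    (hm : 0 ≤ m + d) :
    (dilatePoly d p h).eval (t : ℚ) = ((m + d).toNat.choose d : ℚ) := by
  have hp' : (p : ℚ) ≠ 0 := by positivity
  have hx : (p : ℚ)⁻¹ * ((t : ℚ) - h) + d = ((m + d).toNat : ℚ) := by
    have h1 : (((m + d).toNat : ℤ) : ℚ) = ((m + d : ℤ) : ℚ) := by rw [Int.toNat_of_nonneg hm]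
    rw [Int.cast_natCast] at h1
    rw [h1, htm]
    push_cast
    field_simp
    ring
  simp only [dilatePoly, eval_mul, eval_C, eval_comp, eval_add, eval_sub, eval_X]
  rw [hx, descPochhammer_eval_eq_descFactorial, Nat.descFactorial_eq_factorial_mul_choose]
  have : (d.factorial : ℚ) ≠ 0 := by positivity
  push_cast
  field_simp

/-- The finitely supported tuples `n` of natural numbers with `h + p * ∑ i, n i = t`. -/
def tuples (κ : Type*) [Fintype κ] (p : ℕ) (h t : ℤ) : Finset (κ →₀ ℕ) :=
  letI := Classical.decEq κ
  if (p : ℤ) ∣ t - h ∧ h ≤ t then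
    Finset.finsuppAntidiag Finset.univ ((t - h) / p).toNat else ∅

lemma mem_tuples {κ : Type*} [Fintype κ] {p : ℕ} (hp : 0 < p) {h t : ℤ} {n : κ →₀ ℕ} :
    n ∈ tuples κ p h t ↔ h + p * ∑ i, (n i : ℤ) = t := by
  classical
  have hp' : (0 : ℤ) < p := by exact_mod_cast hp
  rw [tuples]
  have hnn : 0 ≤ ∑ i, (n i : ℤ) := Finset.sum_nonneg fun i _ => by positivity
  split_ifs with hc
  · obtain ⟨⟨m, hm⟩, hle⟩ := hc
    have hm0 : 0 ≤ m := by
      by_contra! hneg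
      nlinarith
    rw [Finset.mem_finsuppAntidiag, hm, Int.mul_ediv_cancel_left _ hp'.ne']
    simp only [Finset.subset_univ, and_true]
    constructor
    · intro hs
      have : (∑ i, (n i : ℤ)) = m := by
        rw [← Int.toNat_of_nonneg hm0, ← hs]; push_cast; rfl
      rw [this]; linarith
    · intro hs
      have : (∑ i, (n i : ℤ)) = m := by
        have : (p : ℤ) * ∑ i, (n i : ℤ) = p * m := by linarith
        exact mul_left_cancel₀ hp'.ne' this
      rw [← this]
      zify
      rw [Int.toNat_of_nonneg hnn]
  · simp only [Finset.notMem_empty, false_iff]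
    intro hs
    refine hc ⟨⟨∑ i, (n i : ℤ), by linarith⟩, ?_⟩
    nlinarith

lemma card_tuples {κ : Type*} [Fintype κ] {d : ℕ} (hκ : Fintype.card κ = d + 1) {p : ℕ}
    (hp : 0 < p) {h t : ℤ} (ht : 0 < t) (hh : h ≤ (d + 1) * p) :
    ((tuples κ p h t).card : ℚ) =
      if (p : ℤ) ∣ t - h then (dilatePoly d p h).eval (t : ℚ) else 0 := by
  classical
  have hp' : (0 : ℤ) < p := by exact_mod_cast hp
  rw [tuples]
  by_cases hdvd : (p : ℤ) ∣ t - h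
  · obtain ⟨m, hm⟩ := id hdvd
    have hmd : 0 ≤ m + d := by
      by_contra! hneg
      nlinarith
    rw [if_pos hdvd, dilatePoly_eval_of_eq d hp (m := m) (by linarith) hmd]
    by_cases hle : h ≤ t
    · have hm0 : 0 ≤ m := by
        by_contra! hneg
        nlinarith
      rw [if_pos ⟨hdvd, hle⟩, Finset.card_finsuppAntidiag_nat_eq_choose, hm,
        Int.mul_ediv_cancel_left _ hp'.ne', Finset.card_univ, hκ]
      congr 1
      lift m to ℕ using hm0
      rw [Int.toNat_natCast, show ((m : ℤ) + d).toNat = m + d by omega,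
        show d + 1 + m - 1 = m + d by omega]
      exact Nat.choose_symm_add
    · have : m < 0 := by
        by_contra! hneg
        nlinarith
      rw [if_neg (by tauto), Nat.choose_eq_zero_of_lt (by omega)]
      simp
  · rw [if_neg hdvd, if_neg (by tauto)]
    simp

/-! ### Half-open simplicial cones -/

section HalfOpen

variable {κ E : Type*} [AddCommGroup E] [Module ℝ E]

/-- The simplicial cone spanned by the basis `b`, with the facets indexed by `J` removed. -/
def halfOpenCone (b : Module.Basis κ ℝ E) (J : Set κ) : Set E :=
  {x | ∀ i, 0 ≤ b.repr x i ∧ (i ∈ J → 0 < b.repr x i)}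

/-- The fundamental parallelepiped of `halfOpenCone b J`. -/
def halfOpenBox (b : Module.Basis κ ℝ E) (J : Set κ) : Set E :=
  {x | ∀ i, (i ∉ J → 0 ≤ b.repr x i ∧ b.repr x i < 1) ∧ (i ∈ J → 0 < b.repr x i ∧ b.repr x i ≤ 1)}

lemma exists_nat_sub_mem {c : ℝ} {q : Prop} (h0 : 0 ≤ c) (h1 : q → 0 < c) :
    ∃ n : ℕ, (¬ q → 0 ≤ c - n ∧ c - n < 1) ∧ (q → 0 < c - n ∧ c - n ≤ 1) := by
  by_cases hq : q
  · refine ⟨⌈c⌉₊ - 1, fun h => absurd hq h, fun _ => ?_⟩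
    have hc := Nat.ceil_lt_add_one h0
    have hc' := Nat.le_ceil c
    have : 1 ≤ ⌈c⌉₊ := Nat.one_le_ceil_iff.2 (h1 hq)
    push_cast [Nat.cast_sub this]
    constructor <;> linarith
  · refine ⟨⌊c⌋₊, fun _ => ?_, fun h => absurd h hq⟩
    have := Nat.floor_le h0
    have := Nat.lt_floor_add_one c
    constructor <;> linarith

lemma nat_eq_of_add_eq_add {x y : ℝ} {q : Prop} {n m : ℕ}
    (hx : (¬ q → 0 ≤ x ∧ x < 1) ∧ (q → 0 < x ∧ x ≤ 1))
    (hy : (¬ q → 0 ≤ y ∧ y < 1) ∧ (q → 0 < y ∧ y ≤ 1)) (h : x + n = y + m) : n = m := by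
  have h1 : (n : ℝ) - m < 1 ∧ (m : ℝ) - n < 1 := by
    by_cases hq : q
    · have := hx.2 hq
      have := hy.2 hq
      constructor <;> linarith
    · have := hx.1 hq
      have := hy.1 hq
      constructor <;> linarith
  have h2 : (n : ℝ) < m + 1 := by linarith
  have h3 : (m : ℝ) < n + 1 := by linarith
  have h2' : n < m + 1 := by exact_mod_cast h2
  have h3' : m < n + 1 := by exact_mod_cast h3
  omega

lemma halfOpenBox_subset (b : Module.Basis κ ℝ E) (J : Set κ) :
    halfOpenBox b J ⊆ {x | ∀ i, 0 ≤ b.repr x i ∧ b.repr x i ≤ 1} := by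
  intro x hx i
  by_cases hi : i ∈ J
  · exact ⟨((hx i).2 hi).1.le, ((hx i).2 hi).2⟩
  · exact ⟨((hx i).1 hi).1, ((hx i).1 hi).2.le⟩

lemma sum_sub_mem_halfOpenBox [Fintype κ] {b : Module.Basis κ ℝ E} {J : Set κ} {x : E}
    (hx : x ∈ halfOpenBox b J) : ∑ i, b i - x ∈ halfOpenBox b Jᶜ := by
  classical
  intro i
  have : b.repr (∑ i, b i - x) i = 1 - b.repr x i := by
    simp [Finsupp.single_apply]
  rw [this]
  constructor
  · intro hi
    have := (hx i).2 (by simpa using hi)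
    constructor <;> linarith
  · intro hi
    have := (hx i).1 hi
    constructor <;> linarith

/-- A lattice containing the basis `b` on which the height `ht` takes integer values; the height of
each basis vector is `p`. -/
structure IsAdapted (b : Module.Basis κ ℝ E) (Λ : AddSubgroup E) (ht : E →ₗ[ℝ] ℝ) (p : ℕ) :
    Prop where
  basis_mem : ∀ i, b i ∈ Λ
  height_int : ∀ x ∈ Λ, ∃ n : ℤ, ht x = n
  height_basis : ∀ i, ht (b i) = p
  finite_box : ({x | ∀ i, 0 ≤ b.repr x i ∧ b.repr x i ≤ 1} ∩ (Λ : Set E)).Finite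

namespace IsAdapted

variable {b : Module.Basis κ ℝ E} {Λ : AddSubgroup E} {ht : E →ₗ[ℝ] ℝ} {p : ℕ}

lemma height_eq_floor (hb : IsAdapted b Λ ht p) {x : E} (hx : x ∈ Λ) : ht x = ⌊ht x⌋ := by
  obtain ⟨n, hn⟩ := hb.height_int x hx
  simp [hn]

/-- The lattice points of the half-open fundamental parallelepiped. -/
def boxPoints (hb : IsAdapted b Λ ht p) (J : Set κ) : Finset E :=
  (hb.finite_box.subset (inter_subset_inter_left _ (halfOpenBox_subset b J))).toFinset

lemma mem_boxPoints (hb : IsAdapted b Λ ht p) {J : Set κ} {x : E} :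
    x ∈ hb.boxPoints J ↔ x ∈ halfOpenBox b J ∧ x ∈ Λ := by
  simp [boxPoints]

/-- The constituent, for the residue class of `r` modulo `p`, of the quasi-polynomial counting
lattice points in `halfOpenCone b J`. -/
def conePoly (hb : IsAdapted b Λ ht p) (J : Set κ) (d : ℕ) (r : ℤ) : ℚ[X] :=
  ∑ x ∈ hb.boxPoints J, if (p : ℤ) ∣ r - ⌊ht x⌋ then dilatePoly d p ⌊ht x⌋ else 0

lemma conePoly_congr (hb : IsAdapted b Λ ht p) (J : Set κ) (d : ℕ) {r s : ℤ}
    (h : (p : ℤ) ∣ r - s) : hb.conePoly J d r = hb.conePoly J d s := by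
  refine Finset.sum_congr rfl fun x _ => ?_
  have : (p : ℤ) ∣ r - ⌊ht x⌋ ↔ (p : ℤ) ∣ s - ⌊ht x⌋ := by
    rw [show r - ⌊ht x⌋ = (r - s) + (s - ⌊ht x⌋) by ring]
    exact dvd_add_right h
  simp only [this]

variable [Fintype κ]

lemma height_eq_sum (hb : IsAdapted b Λ ht p) (x : E) : ht x = p * ∑ i, b.repr x i := by
  conv_lhs => rw [← b.sum_repr x, map_sum]
  simp only [map_smul, hb.height_basis, smul_eq_mul, Finset.mul_sum, mul_comm]

lemma floor_height_sum_sub (hb : IsAdapted b Λ ht p) {d : ℕ} (hκ : Fintype.card κ = d + 1) (x : E)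
    (hx : x ∈ Λ) : ⌊ht (∑ i, b i - x)⌋ = (d + 1) * p - ⌊ht x⌋ := by
  rw [map_sub, hb.height_eq_floor hx]
  simp [hb.height_basis, hκ]
  norm_cast
  exact Int.floor_natCast _

lemma conePoly_reciprocity (hb : IsAdapted b Λ ht p) (hp : 0 < p) {d : ℕ}
    (hκ : Fintype.card κ = d + 1) (J : Set κ) (t : ℤ) (x : ℚ) :
    (-1 : ℚ) ^ d * (hb.conePoly J d (-t)).eval (-x) = (hb.conePoly Jᶜ d t).eval x := by
  rw [conePoly, conePoly, eval_finsetSum, eval_finsetSum, Finset.mul_sum]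
  refine Finset.sum_nbij' (fun y => ∑ i, b i - y) (fun y => ∑ i, b i - y) ?_ ?_ ?_ ?_ ?_
  · intro y hy
    rw [hb.mem_boxPoints] at hy ⊢
    exact ⟨sum_sub_mem_halfOpenBox hy.1, Λ.sub_mem (Λ.sum_mem fun i _ => hb.basis_mem i) hy.2⟩
  · intro y hy
    rw [hb.mem_boxPoints] at hy ⊢
    refine ⟨?_, Λ.sub_mem (Λ.sum_mem fun i _ => hb.basis_mem i) hy.2⟩
    simpa using sum_sub_mem_halfOpenBox hy.1
  · intro y _; simp
  · intro y _; simp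
  · intro y hy
    rw [hb.mem_boxPoints] at hy
    rw [hb.floor_height_sum_sub hκ y hy.2]
    have : (p : ℤ) ∣ -t - ⌊ht y⌋ ↔ (p : ℤ) ∣ t - ((d + 1) * p - ⌊ht y⌋) := by
      rw [← dvd_neg,
        show t - ((d + 1) * (p : ℤ) - ⌊ht y⌋) = -(-t - ⌊ht y⌋) + p * (-(d + 1)) by ring,
        dvd_add_left (dvd_mul_right _ _)]
    simp only [this]
    split_ifs
    · exact dilatePoly_eval_neg d hp _ _
    · simp

lemma repr_add_sum (x : E) (n : κ →₀ ℕ) (i : κ) :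
    b.repr (x + ∑ i, (n i : ℝ) • b i) i = b.repr x i + n i := by
  classical
  simp [Finsupp.single_apply]

lemma coneSlice_eq_image (hb : IsAdapted b Λ ht p) (hp : 0 < p) (J : Set κ) (t : ℤ) :
    {x ∈ halfOpenCone b J | x ∈ Λ ∧ ht x = t} =
      (fun σ : (_ : E) × (κ →₀ ℕ) => σ.1 + ∑ i, (σ.2 i : ℝ) • b i) ''
        ((hb.boxPoints J).sigma fun x => tuples κ p ⌊ht x⌋ t : Finset _) := by
  have hmem : ∀ n : κ →₀ ℕ, ∑ i, (n i : ℝ) • b i ∈ Λ := fun n =>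
    Λ.sum_mem fun i _ => by
      rw [Nat.cast_smul_eq_nsmul]
      exact Λ.nsmul_mem (hb.basis_mem i) _
  have hht : ∀ (x : E) (n : κ →₀ ℕ), x ∈ Λ →
      ht (x + ∑ i, (n i : ℝ) • b i) = ((⌊ht x⌋ + p * ∑ i, (n i : ℤ) : ℤ) : ℝ) := by
    intro x n hx
    push_cast
    rw [map_add, ← hb.height_eq_floor hx]
    simp [hb.height_basis, Finset.mul_sum, mul_comm]
  ext x
  constructor
  · rintro ⟨hx, hxΛ, hxt⟩
    choose n hn using fun i => exists_nat_sub_mem (hx i).1 (hx i).2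
    let n' : κ →₀ ℕ := Finsupp.equivFunOnFinite.symm n
    have hy : x - ∑ i, (n' i : ℝ) • b i + ∑ i, (n' i : ℝ) • b i = x := by abel
    have hyΛ := Λ.sub_mem hxΛ (hmem n')
    refine ⟨⟨x - ∑ i, (n' i : ℝ) • b i, n'⟩, ?_, hy⟩
    rw [Finset.mem_coe, Finset.mem_sigma, hb.mem_boxPoints, mem_tuples hp]
    refine ⟨⟨fun i => ?_, hyΛ⟩, ?_⟩
    · have : b.repr (x - ∑ i, (n' i : ℝ) • b i) i = b.repr x i - n i := by
        have := repr_add_sum (b := b) (x - ∑ i, (n' i : ℝ) • b i) n' i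
        rw [hy] at this
        rw [this]
        simp [n']
      rw [this]
      exact hn i
    · have := hht _ n' hyΛ
      rw [hy, hxt] at this
      exact_mod_cast this.symm
  · rintro ⟨⟨y, n⟩, hσ, rfl⟩
    rw [Finset.mem_coe, Finset.mem_sigma, hb.mem_boxPoints, mem_tuples hp] at hσ
    obtain ⟨⟨hy, hyΛ⟩, hn⟩ := hσ
    refine ⟨fun i => ?_, Λ.add_mem hyΛ (hmem n), ?_⟩
    · dsimp only
      rw [repr_add_sum]
      have h0 : (0 : ℝ) ≤ n i := by positivity
      have := (halfOpenBox_subset b J hy i).1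
      exact ⟨by linarith, fun hi => by linarith [((hy i).2 hi).1]⟩
    · dsimp only
      rw [hht y n hyΛ, hn]

lemma finite_coneSlice (hb : IsAdapted b Λ ht p) (hp : 0 < p) (J : Set κ) (t : ℤ) :
    {x ∈ halfOpenCone b J | x ∈ Λ ∧ ht x = t}.Finite := by
  rw [hb.coneSlice_eq_image hp]
  exact (Finset.finite_toSet _).image _

lemma ncard_coneSlice (hb : IsAdapted b Λ ht p) (hp : 0 < p) {d : ℕ}
    (hκ : Fintype.card κ = d + 1) (J : Set κ) {t : ℤ} (h0 : 0 < t) :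
    ({x ∈ halfOpenCone b J | x ∈ Λ ∧ ht x = t}.ncard : ℚ) = (hb.conePoly J d t).eval (t : ℚ) := by
  rw [hb.coneSlice_eq_image hp, InjOn.ncard_image, ncard_coe_finset, Finset.card_sigma, conePoly,
    eval_finsetSum, Nat.cast_sum]
  · refine Finset.sum_congr rfl fun y hy => ?_
    rw [hb.mem_boxPoints] at hy
    rw [card_tuples hκ hp h0]
    · split_ifs <;> simp
    · have : ht y ≤ (d + 1) * p := by
        rw [hb.height_eq_sum, mul_comm]
        gcongr
        calc ∑ i, b.repr y i ≤ ∑ i : κ, (1 : ℝ) :=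
              Finset.sum_le_sum fun i _ => (halfOpenBox_subset b J hy.1 i).2
          _ = d + 1 := by simp [hκ]
      rw [hb.height_eq_floor hy.2] at this
      exact_mod_cast this
  · rintro ⟨y, n⟩ hy ⟨z, m⟩ hz h
    rw [Finset.mem_coe, Finset.mem_sigma, hb.mem_boxPoints] at hy hz
    dsimp only at h hy hz
    have hnm : n = m := by
      ext i
      have hi := congrArg (fun x => b.repr x i) h
      simp only [repr_add_sum] at hi
      exact nat_eq_of_add_eq_add (hy.1.1 i) (hz.1.1 i) hi
    subst hnm
    simpa using h

end IsAdapted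

end HalfOpen

/-! ### Regular triangulations of polyhedral cones -/

section Triangulation

open Filter Topology Module

variable {ι E : Type*} [AddCommGroup E] [Module ℝ E]

/-- The finite sets of generators forming a basis of the ambient space. -/
abbrev BasisSet (w : ι → E) : Type _ :=
  {B : Finset ι // LinearIndependent ℝ (fun i : B => w i) ∧
    ⊤ ≤ Submodule.span ℝ (range fun i : B => w i)}

/-- A point is generic if it lies in no proper subspace spanned by generators. -/
def IsGeneric (w : ι → E) (y : E) : Prop :=
  ∀ B : Finset ι, Submodule.span ℝ (w '' B) ≠ ⊤ → y ∉ Submodule.span ℝ (w '' B)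

lemma eventually_add_smul_notMem {U : Submodule ℝ E} {q : E} (hq : q ∉ U) (x : E) :
    ∀ᶠ ε in 𝓝[>] (0 : ℝ), x + ε • q ∉ U := by
  by_cases h : ∃ δ : ℝ, 0 < δ ∧ x + δ • q ∈ U
  · obtain ⟨δ, hδ, hU⟩ := h
    filter_upwards [Ioo_mem_nhdsGT hδ] with ε hε hεU
    have := U.sub_mem hU hεU
    rw [add_sub_add_left_eq_sub, ← sub_smul] at this
    exact hq ((U.smul_mem_iff (sub_pos.2 hε.2).ne').1 this)
  · push Not at h
    filter_upwards [self_mem_nhdsWithin] with ε hε using h ε hε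

lemma IsGeneric.eventually_add_smul [Finite ι] {w : ι → E} {q : E} (hq : IsGeneric w q) (x : E) :
    ∀ᶠ ε in 𝓝[>] (0 : ℝ), IsGeneric w (x + ε • q) := by
  have := Fintype.ofFinite ι
  refine eventually_all.2 fun B => ?_
  by_cases hB : Submodule.span ℝ (w '' B) = ⊤
  · exact .of_forall fun ε h => absurd hB h
  · filter_upwards [eventually_add_smul_notMem (hq B hB) x] with ε hε _ using hε

lemma IsGeneric.neg {w : ι → E} {q : E} (hq : IsGeneric w q) : IsGeneric w (-q) :=
  fun B hB h => hq B hB (by simpa using h)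

lemma exists_isGeneric [Finite ι] (w : ι → E) : ∃ q, IsGeneric w q := by
  have := Fintype.ofFinite ι
  obtain ⟨q, hq⟩ := Submodule.exists_forall_notMem_of_forall_ne_top
    (fun B : {B : Finset ι // Submodule.span ℝ (w '' B) ≠ ⊤} => Submodule.span ℝ (w '' B.1))
    fun B => B.2
  exact ⟨q, fun B hB => hq ⟨B, hB⟩⟩

namespace BasisSet

variable {w : ι → E}

/-- The basis of the ambient space given by a basis set. -/
def basis (B : BasisSet w) : Basis B.1 ℝ E := Basis.mk B.2.1 B.2.2

@[simp] lemma basis_apply (B : BasisSet w) (i : B.1) : B.basis i = w i := by simp [basis]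

/-- The open simplicial cone spanned by a basis set. -/
def openCone (B : BasisSet w) : Set E := {x | ∀ i, 0 < B.basis.repr x i}

open Classical in
/-- The coefficient of the generator `i` in the expansion with respect to a basis set. -/
def coeff (B : BasisSet w) (i : ι) : E →ₗ[ℝ] ℝ :=
  if h : i ∈ B.1 then B.basis.coord ⟨i, h⟩ else 0

lemma coeff_of_mem (B : BasisSet w) {i : ι} (h : i ∈ B.1) (x : E) :
    B.coeff i x = B.basis.repr x ⟨i, h⟩ := by simp [coeff, h]

lemma coeff_of_notMem (B : BasisSet w) {i : ι} (h : i ∉ B.1) (x : E) : B.coeff i x = 0 := by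
  simp [coeff, h]

lemma coeff_pos {B : BasisSet w} {x : E} (hx : x ∈ B.openCone) {i : ι} (h : i ∈ B.1) :
    0 < B.coeff i x := by
  rw [B.coeff_of_mem h]
  exact hx _

lemma coeff_nonneg {B : BasisSet w} {x : E} (hx : x ∈ B.openCone) (i : ι) : 0 ≤ B.coeff i x := by
  by_cases h : i ∈ B.1
  · exact (coeff_pos hx h).le
  · rw [B.coeff_of_notMem h]

lemma sum_mem_coeff_smul (B : BasisSet w) (x : E) : ∑ i ∈ B.1, B.coeff i x • w i = x := by
  conv_rhs => rw [← B.basis.sum_repr x]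
  rw [← Finset.sum_coe_sort]
  refine Finset.sum_congr rfl fun i _ => ?_
  rw [B.coeff_of_mem i.2, basis_apply]

lemma basis_repr_ne_zero {q : E} (hq : IsGeneric w q) (B : BasisSet w) (i : B.1) :
    B.basis.repr q i ≠ 0 := by
  classical
  intro h0
  have hle : Submodule.span ℝ (w '' (B.1.erase i : Finset ι)) ≤
      LinearMap.ker (B.basis.coord i) := by
    rw [Submodule.span_le]
    rintro _ ⟨j, hj, rfl⟩
    rw [Finset.mem_coe, Finset.mem_erase] at hj
    have : w j = B.basis ⟨j, hj.2⟩ := by simp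
    rw [this, SetLike.mem_coe, LinearMap.mem_ker, Basis.coord_apply, Basis.repr_self,
      Finsupp.single_apply, if_neg]
    exact fun h => hj.1 (congrArg Subtype.val h)
  refine hq (B.1.erase i) (fun htop => ?_) ?_
  · have : B.basis i ∈ LinearMap.ker (B.basis.coord i) :=
      hle (by rw [htop]; exact Submodule.mem_top)
    rw [LinearMap.mem_ker, Basis.coord_apply, Basis.repr_self] at this
    simp at this
  · rw [← B.sum_mem_coeff_smul q]
    refine Submodule.sum_mem _ fun j hj => ?_
    by_cases hji : j = i
    · subst hji
      rw [B.coeff_of_mem i.2, h0, zero_smul]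
      exact Submodule.zero_mem _
    · exact Submodule.smul_mem _ _
        (Submodule.subset_span ⟨j, by simpa using ⟨hj, hji⟩, rfl⟩)

variable [Fintype ι]

lemma sum_coeff_smul (B : BasisSet w) (x : E) : ∑ i, B.coeff i x • w i = x := by
  conv_rhs => rw [← B.sum_mem_coeff_smul x]
  refine (Finset.sum_subset (Finset.subset_univ _) fun i _ hi => ?_).symm
  rw [B.coeff_of_notMem hi, zero_smul]

lemma coeff_sum (B : BasisSet w) {c : ι → ℝ} (hc : ∀ i ∉ B.1, c i = 0) (j : ι) :
    B.coeff j (∑ i, c i • w i) = c j := by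
  by_cases hj : j ∈ B.1
  · have : ∑ i, c i • w i = ∑ i : B.1, c i • B.basis i := by
      simp only [basis_apply]
      rw [Finset.sum_coe_sort B.1 (fun i => c i • w i)]
      refine (Finset.sum_subset (Finset.subset_univ _) fun i _ hi => ?_).symm
      rw [hc i hi, zero_smul]
    rw [B.coeff_of_mem hj, this, Basis.repr_sum_self]
  · rw [B.coeff_of_notMem hj, hc j hj]

/-- The linear functional on the ambient space taking the value `ω i` at each generator `w i` in the
basis set. -/
def cost (ω : ι → ℝ) (B : BasisSet w) : E →ₗ[ℝ] ℝ := ∑ i, ω i • B.coeff i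

lemma cost_apply (ω : ι → ℝ) (B : BasisSet w) (x : E) : B.cost ω x = ∑ i, ω i * B.coeff i x := by
  simp [cost]

/-- A basis set is regular for the weights `ω` if it spans a cell of the subdivision of the cone
induced by lifting each generator `w i` to height `ω i`. -/
def IsRegular (ω : ι → ℝ) (B : BasisSet w) : Prop := ∀ j, B.cost ω (w j) ≤ ω j

lemma exists_weights (w : ι → E) :
    ∃ ω : ι → ℝ, ∀ (B : BasisSet w), ∀ j ∉ B.1, B.cost ω (w j) ≠ ω j := by
  classical
  obtain ⟨ω, hω⟩ := Module.Dual.exists_forall_ne_zero_of_forall_exists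
    (fun s : {s : BasisSet w × ι // s.2 ∉ s.1.1} =>
      (∑ i, s.1.1.coeff i (w s.1.2) • LinearMap.proj i - LinearMap.proj s.1.2 :
        Module.Dual ℝ (ι → ℝ))) (by
      rintro ⟨⟨B, j⟩, hj⟩
      refine ⟨Pi.single j 1, ?_⟩
      dsimp only at hj ⊢
      simp [Pi.single_apply, B.coeff_of_notMem hj])
  refine ⟨ω, fun B j hj h => hω ⟨(B, j), hj⟩ ?_⟩
  rw [cost_apply] at h
  simp [← h, mul_comm]

lemma eq_of_mem_openCone {ω : ι → ℝ} (hω : ∀ (B : BasisSet w), ∀ j ∉ B.1, B.cost ω (w j) ≠ ω j)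
    {B B' : BasisSet w} (hB : B.IsRegular ω) (hB' : B'.IsRegular ω) {y : E} (hy : y ∈ B.openCone)
    (hy' : y ∈ B'.openCone) : B = B' := by
  have key : ∀ {B B' : BasisSet w}, B.IsRegular ω → y ∈ B'.openCone →
      B.cost ω y ≤ B'.cost ω y ∧ (¬ B'.1 ⊆ B.1 → B.cost ω y < B'.cost ω y) := by
    intro B B' hB hy'
    have h1 : B.cost ω y = ∑ i, B.cost ω (w i) * B'.coeff i y := by
      conv_lhs => rw [← B'.sum_coeff_smul y, map_sum]
      simp only [map_smul, smul_eq_mul, mul_comm]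
    rw [h1, cost_apply]
    have hle : ∀ i ∈ Finset.univ, B.cost ω (w i) * B'.coeff i y ≤ ω i * B'.coeff i y :=
      fun i _ => mul_le_mul_of_nonneg_right (hB i) (coeff_nonneg hy' i)
    refine ⟨Finset.sum_le_sum hle, fun hsub => ?_⟩
    obtain ⟨j, hj', hj⟩ := Finset.not_subset.1 hsub
    exact Finset.sum_lt_sum hle ⟨j, Finset.mem_univ j,
      mul_lt_mul_of_pos_right (lt_of_le_of_ne (hB j) (hω B j hj)) (coeff_pos hy' hj')⟩
  refine Subtype.ext (subset_antisymm ?_ ?_)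
  · by_contra h
    exact absurd ((key hB' hy).2 h) (key hB hy').1.not_gt
  · by_contra h
    exact absurd ((key hB hy').2 h) (key hB' hy).1.not_gt

/-- **Carathéodory's theorem** for cones, with control of a linear cost. -/
lemma exists_linearIndependent_le (ht : E →ₗ[ℝ] ℝ) (hw : ∀ i, 0 < ht (w i)) (ω : ι → ℝ)
    (a : ι → ℝ) (ha : ∀ i, 0 ≤ a i) :
    ∃ (B : Finset ι) (c : ι → ℝ), LinearIndependent ℝ (fun i : B => w i) ∧ (∀ i ∈ B, 0 < c i) ∧
      (∀ i ∉ B, c i = 0) ∧ ∑ i, c i • w i = ∑ i, a i • w i ∧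
      ∑ i, ω i * c i ≤ ∑ i, ω i * a i := by
  classical
  induction hn : (Finset.univ.filter fun i => a i ≠ 0).card using Nat.strong_induction_on
    generalizing a with
  | _ n ih =>
  set B := Finset.univ.filter fun i => a i ≠ 0 with hBdef
  by_cases hB : LinearIndependent ℝ (fun i : B => w i)
  · exact ⟨B, a, hB, fun i hi => lt_of_le_of_ne (ha i) (by simpa [B, eq_comm] using hi),
      fun i hi => by simpa [B] using hi, rfl, le_rfl⟩
  obtain ⟨g, hgB, hg, hgω, hg0⟩ : ∃ g : ι → ℝ, (∀ i ∉ B, g i = 0) ∧ ∑ i, g i • w i = 0 ∧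
      0 ≤ ∑ i, ω i * g i ∧ ∃ i, g i ≠ 0 := by
    obtain ⟨g, hg, i, hi⟩ := Fintype.not_linearIndependent_iff.1 hB
    let g' : ι → ℝ := fun j => if h : j ∈ B then g ⟨j, h⟩ else 0
    have hg'B : ∀ j ∉ B, g' j = 0 := fun j hj => by simp [g', hj]
    have hg' : ∑ j, g' j • w j = 0 := by
      rw [← hg, ← Finset.sum_subset (Finset.subset_univ B) fun j _ hj => by simp [hg'B j hj],
        ← Finset.sum_coe_sort]
      exact Finset.sum_congr rfl fun j _ => by simp [g']
    have hg'0 : g' i ≠ 0 := by simpa [g'] using hi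
    rcases le_total 0 (∑ j, ω j * g' j) with h | h
    · exact ⟨g', hg'B, hg', h, i, hg'0⟩
    · exact ⟨-g', fun j hj => by simp [hg'B j hj], by simp [hg'], by simpa using h, i, by simpa⟩
  obtain ⟨i₁, hi₁⟩ : ∃ i, 0 < g i := by
    by_contra! hneg
    obtain ⟨i, hi⟩ := hg0
    have h1 : ∑ i, g i * ht (w i) = 0 := by simpa using congrArg ht hg
    have h2 := (Finset.sum_eq_zero_iff_of_nonpos fun i _ =>
      mul_nonpos_of_nonpos_of_nonneg (hneg i) (hw i).le).1 h1 i (Finset.mem_univ i)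
    exact hi ((mul_eq_zero.1 h2).resolve_right (hw i).ne')
  obtain ⟨i₀, hi₀, hmin⟩ := Finset.exists_min_image (Finset.univ.filter fun i => 0 < g i)
    (fun i => a i / g i) ⟨i₁, by simpa⟩
  simp only [Finset.mem_filter, Finset.mem_univ, true_and] at hi₀ hmin
  set s := a i₀ / g i₀
  have hs : 0 ≤ s := div_nonneg (ha _) hi₀.le
  have hs0 : a i₀ - s * g i₀ = 0 := by simp [s, hi₀.ne']
  have ha' : ∀ i, 0 ≤ a i - s * g i := by
    intro i
    rcases le_or_gt (g i) 0 with h | h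
    · nlinarith [ha i, mul_nonneg hs (neg_nonneg.2 h)]
    · have := (le_div_iff₀ h).1 (hmin i h)
      linarith
  have hlt : (Finset.univ.filter fun i => a i - s * g i ≠ 0).card < n := by
    rw [← hn]
    refine Finset.card_lt_card ⟨fun i hi => ?_, fun hsub => ?_⟩
    · by_contra hiB
      have h1 : a i = 0 := by simpa [B] using hiB
      simp [h1, hgB i hiB] at hi
    · have : i₀ ∈ B := by
        by_contra h
        exact hi₀.ne' (hgB _ h)
      simpa [hs0] using hsub this
  obtain ⟨B', c, h1, h2, h3, h4, h5⟩ := ih _ hlt (fun i => a i - s * g i) ha' rfl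
  refine ⟨B', c, h1, h2, h3, ?_, h5.trans ?_⟩
  · rw [h4]
    simp only [sub_smul, Finset.sum_sub_distrib, mul_smul, ← Finset.smul_sum, hg, smul_zero,
      sub_zero]
  · have : ∑ i, ω i * (a i - s * g i) = ∑ i, ω i * a i - s * ∑ i, ω i * g i := by
      rw [Finset.mul_sum, ← Finset.sum_sub_distrib]
      exact Finset.sum_congr rfl fun i _ => by ring
    rw [this]
    have := mul_nonneg hs hgω
    linarith

lemma exists_mem_openCone_cost_le (ht : E →ₗ[ℝ] ℝ) (hw : ∀ i, 0 < ht (w i)) (ω : ι → ℝ)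
    {a : ι → ℝ} (ha : ∀ i, 0 ≤ a i) (hy : IsGeneric w (∑ i, a i • w i)) :
    ∃ B : BasisSet w, ∑ i, a i • w i ∈ B.openCone ∧
      B.cost ω (∑ i, a i • w i) ≤ ∑ i, ω i * a i := by
  obtain ⟨B, c, hB, hpos, hzero, hsum, hle⟩ := exists_linearIndependent_le ht hw ω a ha
  have hspan : Submodule.span ℝ (w '' B) = ⊤ := by
    by_contra h
    refine hy B h ?_
    rw [← hsum]
    refine Submodule.sum_mem _ fun i _ => ?_
    by_cases hi : i ∈ B
    · exact Submodule.smul_mem _ _ (Submodule.subset_span ⟨i, hi, rfl⟩)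
    · rw [hzero i hi, zero_smul]
      exact Submodule.zero_mem _
  have hrange : range (fun i : B => w i) = w '' B := by
    ext x
    simp
  let B' : BasisSet w := ⟨B, hB, by rw [hrange, hspan]⟩
  rw [← hsum]
  refine ⟨B', fun i => ?_, ?_⟩
  · rw [← B'.coeff_of_mem i.2, B'.coeff_sum hzero]
    exact hpos i i.2
  · rw [cost_apply]
    simpa only [B'.coeff_sum hzero] using hle

lemma exists_isRegular (ht : E →ₗ[ℝ] ℝ) (hw : ∀ i, 0 < ht (w i)) (ω : ι → ℝ)
    {a : ι → ℝ} (ha : ∀ i, 0 ≤ a i) (hy : IsGeneric w (∑ i, a i • w i)) :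
    ∃ B : BasisSet w, B.IsRegular ω ∧ ∑ i, a i • w i ∈ B.openCone := by
  classical
  set y := ∑ i, a i • w i
  obtain ⟨B₀, hB₀, -⟩ := exists_mem_openCone_cost_le ht hw ω ha hy
  obtain ⟨B, hB, hmin⟩ := Set.exists_min_image {B : BasisSet w | y ∈ B.openCone}
    (fun B => B.cost ω y) (Set.toFinite _) ⟨B₀, hB₀⟩
  refine ⟨B, fun j => ?_, hB⟩
  by_contra! hj
  obtain ⟨ε, hε, hnn⟩ : ∃ ε : ℝ, 0 < ε ∧ ∀ i, 0 ≤ B.coeff i y - ε * B.coeff i (w j) := by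
    have hev : ∀ᶠ ε in 𝓝[>] (0 : ℝ), ∀ i, 0 ≤ B.coeff i y - ε * B.coeff i (w j) := by
      refine eventually_all.2 fun i => ?_
      by_cases hi : i ∈ B.1
      · have hcont : Continuous fun ε : ℝ => B.coeff i y - ε * B.coeff i (w j) := by fun_prop
        exact ((hcont.tendsto' 0 (B.coeff i y) (by simp)).eventually_const_le
          (coeff_pos hB hi)).filter_mono nhdsWithin_le_nhds
      · exact .of_forall fun ε => by simp [B.coeff_of_notMem hi]
    obtain ⟨ε, h1, h2⟩ := (hev.and self_mem_nhdsWithin).exists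
    exact ⟨ε, h2, h1⟩
  let a' : ι → ℝ := fun i => B.coeff i y - ε * B.coeff i (w j) + ε * (if i = j then 1 else 0)
  have ha' : ∀ i, 0 ≤ a' i := fun i => by
    have := hnn i
    have : 0 ≤ ε * (if i = j then (1 : ℝ) else 0) := by positivity
    simp only [a']
    linarith
  have hsum : ∑ i, a' i • w i = y := by
    simp only [a', add_smul, sub_smul, mul_smul, Finset.sum_add_distrib, Finset.sum_sub_distrib,
      ← Finset.smul_sum, sum_coeff_smul]
    simp
  have hcost : ∑ i, ω i * a' i = B.cost ω y - ε * B.cost ω (w j) + ε * ω j := by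
    rw [cost_apply, cost_apply]
    simp only [a', mul_add, mul_sub, Finset.sum_add_distrib, Finset.sum_sub_distrib,
      Finset.mul_sum]
    congr 1
    · congr 1
      exact Finset.sum_congr rfl fun i _ => by ring
    · simp [mul_comm]
  obtain ⟨B', hB', hle⟩ := exists_mem_openCone_cost_le ht hw ω ha' (by rwa [hsum])
  rw [hsum] at hB' hle
  have := hmin B' hB'
  nlinarith

lemma exists_nonneg_sum_iff (ht : E →ₗ[ℝ] ℝ) (hw : ∀ i, 0 < ht (w i)) (ω : ι → ℝ) {y : E}
    (hy : IsGeneric w y) : (∃ a : ι → ℝ, (∀ i, 0 ≤ a i) ∧ ∑ i, a i • w i = y) ↔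
      ∃ B : BasisSet w, B.IsRegular ω ∧ y ∈ B.openCone := by
  constructor
  · rintro ⟨a, ha, rfl⟩
    exact exists_isRegular ht hw ω ha hy
  · rintro ⟨B, -, hB⟩
    exact ⟨fun i => B.coeff i y, coeff_nonneg hB, B.sum_coeff_smul y⟩

end BasisSet

end Triangulation

/-! ### Half-open decompositions -/

section Perturbation

open Filter Topology Module

variable {E : Type*} [AddCommGroup E] [Module ℝ E]

lemma eventually_pos_add_mul_iff {a : ℝ} (ha : a ≠ 0) (c : ℝ) :
    ∀ᶠ ε in 𝓝[>] (0 : ℝ), (0 < c + ε * a ↔ 0 ≤ c ∧ (a < 0 → 0 < c)) := by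
  have hcont : Tendsto (fun ε : ℝ => c + ε * a) (𝓝[>] 0) (𝓝 c) :=
    (Continuous.tendsto' (by fun_prop) 0 c (by simp)).mono_left nhdsWithin_le_nhds
  rcases lt_trichotomy c 0 with hc | rfl | hc
  · filter_upwards [hcont.eventually_lt_const hc] with ε hε
    exact ⟨fun h => absurd h hε.not_gt, fun h => absurd h.1 hc.not_ge⟩
  · filter_upwards [self_mem_nhdsWithin] with ε hε
    rw [zero_add, mul_pos_iff_of_pos_left hε]
    exact ⟨fun h => ⟨le_rfl, fun h' => absurd h h'.not_gt⟩,
      fun h => lt_of_le_of_ne (not_lt.1 fun h' => (h.2 h').false) ha.symm⟩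
  · filter_upwards [hcont.eventually_const_lt hc] with ε hε
    exact ⟨fun _ => ⟨hc.le, fun _ => hc⟩, fun _ => hε⟩

lemma eventually_repr_pos_iff {κ : Type*} [Finite κ] (b : Basis κ ℝ E) {q : E}
    (hq : ∀ i, b.repr q i ≠ 0) (x : E) :
    ∀ᶠ ε in 𝓝[>] (0 : ℝ),
      ((∀ i, 0 < b.repr (x + ε • q) i) ↔ x ∈ halfOpenCone b {i | b.repr q i < 0}) := by
  filter_upwards [eventually_all.2 fun i => eventually_pos_add_mul_iff (hq i) (b.repr x i)]
    with ε hε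
  refine forall_congr' fun i => ?_
  simpa using hε i

namespace BasisSet

variable {ι : Type*} {w : ι → E}

/-- The closed simplicial cone of a basis set with the facets not visible after a shift by a small
positive multiple of `q` removed. -/
def shiftedCone (B : BasisSet w) (q : E) : Set E :=
  halfOpenCone B.basis {i | B.basis.repr q i < 0}

lemma shiftedCone_neg {q : E} (hq : IsGeneric w q) (B : BasisSet w) :
    B.shiftedCone (-q) = halfOpenCone B.basis {i | B.basis.repr q i < 0}ᶜ := by
  rw [shiftedCone]
  congr 1
  ext i
  have := B.basis_repr_ne_zero hq i
  simp only [map_neg, Finsupp.neg_apply, Left.neg_neg_iff, mem_ofPred_eq, mem_compl_iff, not_lt]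
  exact ⟨le_of_lt, fun h => lt_of_le_of_ne h this.symm⟩

variable [Fintype ι]

lemma eventually_mem_openCone_iff {q : E} (hq : IsGeneric w q) (x : E) :
    ∀ᶠ ε in 𝓝[>] (0 : ℝ), ∀ B : BasisSet w, x + ε • q ∈ B.openCone ↔ x ∈ B.shiftedCone q :=
  eventually_all.2 fun B => eventually_repr_pos_iff B.basis (B.basis_repr_ne_zero hq) x

lemma eventually_exists_nonneg_sum_iff (ht : E →ₗ[ℝ] ℝ) (hw : ∀ i, 0 < ht (w i)) (ω : ι → ℝ)
    {q : E} (hq : IsGeneric w q) (x : E) :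
    ∀ᶠ ε in 𝓝[>] (0 : ℝ), (∃ a : ι → ℝ, (∀ i, 0 ≤ a i) ∧ ∑ i, a i • w i = x + ε • q) ↔
      ∃ B : BasisSet w, B.IsRegular ω ∧ x ∈ B.shiftedCone q := by
  filter_upwards [hq.eventually_add_smul x, eventually_mem_openCone_iff hq x] with ε h1 h2
  rw [exists_nonneg_sum_iff ht hw ω h1]
  simp only [h2]

lemma eq_of_mem_shiftedCone {ω : ι → ℝ}
    (hω : ∀ (B : BasisSet w), ∀ j ∉ B.1, B.cost ω (w j) ≠ ω j) {q : E} (hq : IsGeneric w q)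
    {B B' : BasisSet w} (hB : B.IsRegular ω) (hB' : B'.IsRegular ω) {x : E}
    (hx : x ∈ B.shiftedCone q) (hx' : x ∈ B'.shiftedCone q) : B = B' := by
  obtain ⟨ε, hε⟩ := (eventually_mem_openCone_iff hq x).exists
  have hxB := (hε B').2 hx'
  exact eq_of_mem_openCone hω hB hB' ((hε B).2 hx) hxB

/-- The number of lattice points at height `t` in a set that is cut out, at positive heights, by
small shifts into the cone generated by `w` is the sum of the corresponding numbers for half-open
simplicial cones. -/
lemma ncard_eq_sum_shiftedCone (ht : E →ₗ[ℝ] ℝ) (hw : ∀ i, 0 < ht (w i)) {ω : ι → ℝ}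
    (hω : ∀ (B : BasisSet w), ∀ j ∉ B.1, B.cost ω (w j) ≠ ω j)
    {q : E} (hq : IsGeneric w q) (S : Set E) (Λ : AddSubgroup E) (t : ℝ)
    (hS : ∀ x, ht x = t → (x ∈ S ↔ ∀ᶠ ε in 𝓝[>] (0 : ℝ),
      ∃ a : ι → ℝ, (∀ i, 0 ≤ a i) ∧ ∑ i, a i • w i = x + ε • q))
    (hfin : ∀ B : BasisSet w, {x ∈ B.shiftedCone q | x ∈ Λ ∧ ht x = t}.Finite) :
    {x ∈ S | x ∈ Λ ∧ ht x = t}.ncard =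
      ∑ᶠ B : {B : BasisSet w // B.IsRegular ω},
        {x ∈ B.1.shiftedCone q | x ∈ Λ ∧ ht x = t}.ncard := by
  rw [← ncard_iUnion_of_finite fun B : {B : BasisSet w // B.IsRegular ω} => hfin B.1]
  · congr 1
    ext x
    simp only [mem_iUnion, mem_ofPred_eq, exists_and_right]
    refine and_congr_left fun hx => ?_
    rw [hS x hx.2]
    have hev := eventually_exists_nonneg_sum_iff ht hw ω hq x
    rw [eventually_congr hev, eventually_const]
    simp
  · intro B B' hne
    refine Set.disjoint_left.2 fun x hx hx' => hne ?_
    exact Subtype.ext (eq_of_mem_shiftedCone hω hq B.2 B'.2 hx.1 hx'.1)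

end BasisSet

end Perturbation

/-! ### The cone over a polytope -/

section PolytopeCone

open Filter Topology Module

variable {F : Type*} [AddCommGroup F] [Module ℝ F]

/-- The part at positive heights of the cone over `P × {1}`. -/
def coneOver (P : Set F) : Set (F × ℝ) := {y | 0 < y.2 ∧ y.2⁻¹ • y.1 ∈ P}

lemma image_smul_eq_coneOver_slice (P : Set F) {t : ℝ} (ht : 0 < t) (A : Set F) :
    (fun x => (x, t)) '' ((t • P) ∩ A) = {y ∈ coneOver P | y.1 ∈ A ∧ y.2 = t} := by
  ext ⟨x, s⟩
  simp only [mem_image, mem_inter_iff, Prod.mk.injEq, coneOver, mem_ofPred_eq,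
    mem_smul_set_iff_inv_smul_mem₀ ht.ne']
  constructor
  · rintro ⟨x, ⟨h1, h2⟩, rfl, rfl⟩
    exact ⟨⟨ht, h1⟩, h2, rfl⟩
  · rintro ⟨⟨-, h1⟩, h2, rfl⟩
    exact ⟨x, ⟨h1, h2⟩, rfl, rfl⟩

lemma exists_nonneg_sum_iff_mem_coneOver (V : Finset F) {p : ℕ} (hp : 0 < p) {y : F × ℝ}
    (hy : 0 < y.2) :
    (∃ a : V → ℝ, (∀ v, 0 ≤ a v) ∧ ∑ v, a v • ((p : ℝ) • (v : F), (p : ℝ)) = y) ↔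
      y ∈ coneOver (convexHull ℝ (V : Set F)) := by
  classical
  have hp' : (0 : ℝ) < p := by exact_mod_cast hp
  have hfst : ∀ a : V → ℝ, (∑ v, a v • ((p : ℝ) • (v : F), (p : ℝ))).1 =
      ∑ v, a v • (p : ℝ) • (v : F) := fun a => by simp [Prod.fst_sum]
  have hsnd : ∀ a : V → ℝ, (∑ v, a v • ((p : ℝ) • (v : F), (p : ℝ))).2 = ∑ v, a v * p :=
    fun a => by simp [Prod.snd_sum]
  constructor
  · rintro ⟨a, ha, rfl⟩
    refine ⟨hy, ?_⟩
    rw [hsnd] at hy ⊢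
    rw [hfst, Finset.smul_sum]
    simp only [smul_smul]
    refine (convex_convexHull ℝ _).sum_mem (fun v _ => ?_) ?_
      (fun v _ => subset_convexHull ℝ _ v.2)
    · have := ha v
      positivity
    · rw [← Finset.mul_sum, inv_mul_cancel₀ hy.ne']
  · rintro ⟨-, hmem⟩
    obtain ⟨c, hc, hc1, hcy⟩ := Finset.mem_convexHull'.1 hmem
    refine ⟨fun v => y.2 * c v / p, fun v => ?_, Prod.ext ?_ ?_⟩
    · have := hc v v.2
      positivity
    · rw [hfst, ← smul_inv_smul₀ hy.ne' y.1, ← hcy, Finset.smul_sum,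
        ← Finset.sum_coe_sort V (fun v => y.2 • c v • v)]
      refine Finset.sum_congr rfl fun v _ => ?_
      rw [smul_smul, smul_smul]
      congr 1
      field_simp
    · rw [hsnd]
      calc ∑ v : V, y.2 * c v / p * p = y.2 * ∑ v : V, c v := by
            rw [Finset.mul_sum]
            exact Finset.sum_congr rfl fun v _ => div_mul_cancel₀ _ hp'.ne'
        _ = y.2 := by rw [Finset.sum_coe_sort V c, hc1, mul_one]

lemma smul_mem_coneOver {P : Set F} {y : F × ℝ} (hy : y ∈ coneOver P) {ε : ℝ} (hε : 0 < ε) :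
    ε • y ∈ coneOver P := by
  refine ⟨mul_pos hε hy.1, ?_⟩
  have := hy.2
  rw [Prod.smul_fst, Prod.smul_snd, smul_smul, smul_eq_mul, mul_inv_rev, mul_assoc,
    inv_mul_cancel₀ hε.ne', mul_one]
  exact this

lemma eventually_add_smul_snd_pos {y : F × ℝ} (hy : 0 < y.2) (q : F × ℝ) :
    ∀ᶠ ε in 𝓝[>] (0 : ℝ), 0 < (y + ε • q).2 := by
  have h : Tendsto (fun ε : ℝ => (y + ε • q).2) (𝓝[>] 0) (𝓝 y.2) :=
    (Continuous.tendsto' (by fun_prop) 0 y.2 (by simp)).mono_left nhdsWithin_le_nhds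
  exact h.eventually_const_lt hy

lemma coneOver_interior_subset [TopologicalSpace F] (P : Set F) :
    coneOver (interior P) ⊆ coneOver P :=
  fun _ hy => ⟨hy.1, interior_subset hy.2⟩

variable [TopologicalSpace F] [IsTopologicalAddGroup F] [ContinuousSMul ℝ F]

lemma tendsto_inv_smul_add_smul {y : F × ℝ} (hy : 0 < y.2) (q : F × ℝ) :
    Tendsto (fun ε : ℝ => (y + ε • q).2⁻¹ • (y + ε • q).1) (𝓝[>] 0) (𝓝 (y.2⁻¹ • y.1)) := by
  have h : Tendsto (fun ε : ℝ => y + ε • q) (𝓝[>] 0) (𝓝 y) :=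
    (Continuous.tendsto' (by fun_prop) 0 y (by simp)).mono_left nhdsWithin_le_nhds
  exact (((continuous_snd.tendsto y).comp h).inv₀ hy.ne').smul ((continuous_fst.tendsto y).comp h)

lemma eventually_add_smul_mem_coneOver_interior {P : Set F} {y : F × ℝ}
    (hy : y ∈ coneOver (interior P)) (q : F × ℝ) :
    ∀ᶠ ε in 𝓝[>] (0 : ℝ), y + ε • q ∈ coneOver (interior P) :=
  (eventually_add_smul_snd_pos hy.1 q).and
    ((tendsto_inv_smul_add_smul hy.1 q).eventually (isOpen_interior.mem_nhds hy.2))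

lemma add_mem_coneOver_interior {P : Set F} (hP : Convex ℝ P) {y q : F × ℝ} (hy : y ∈ coneOver P)
    (hq : q ∈ coneOver (interior P)) : y + q ∈ coneOver (interior P) := by
  obtain ⟨hy0, hyP⟩ := hy
  obtain ⟨hq0, hqP⟩ := hq
  have hs : 0 < y.2 + q.2 := by positivity
  refine ⟨hs, ?_⟩
  have := hP.combo_self_interior_mem_interior hyP hqP (a := y.2 / (y.2 + q.2))
    (b := q.2 / (y.2 + q.2)) (by positivity) (by positivity) (by field_simp)
  convert this using 1
  rw [Prod.fst_add, Prod.snd_add, smul_add, smul_smul, smul_smul]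
  congr 2
  · field_simp
  · field_simp

lemma mem_coneOver_iff_eventually {P : Set F} (hP : Convex ℝ P) (hPc : IsClosed P) {y q : F × ℝ}
    (hy : 0 < y.2) (hq : q ∈ coneOver (interior P)) :
    y ∈ coneOver P ↔ ∀ᶠ ε in 𝓝[>] (0 : ℝ), y + ε • q ∈ coneOver P := by
  constructor
  · intro h
    filter_upwards [self_mem_nhdsWithin] with ε hε
    exact coneOver_interior_subset P (add_mem_coneOver_interior hP h (smul_mem_coneOver hq hε))
  · intro h
    exact ⟨hy, hPc.mem_of_tendsto (tendsto_inv_smul_add_smul hy q) (h.mono fun ε hε => hε.2)⟩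

lemma mem_coneOver_interior_iff_eventually {P : Set F} (hP : Convex ℝ P) {y q : F × ℝ}
    (hq : q ∈ coneOver (interior P)) :
    y ∈ coneOver (interior P) ↔ ∀ᶠ ε in 𝓝[>] (0 : ℝ), y + ε • -q ∈ coneOver P := by
  constructor
  · intro h
    exact (eventually_add_smul_mem_coneOver_interior h (-q)).mono fun ε hε =>
      coneOver_interior_subset P hε
  · intro h
    obtain ⟨ε, hε, h0⟩ := (h.and self_mem_nhdsWithin).exists
    simpa using add_mem_coneOver_interior hP hε (smul_mem_coneOver hq h0)

lemma exists_isGeneric_mem_coneOver_interior {ι : Type*} [Finite ι] (w : ι → F × ℝ) {P : Set F}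
    (hP : (interior P).Nonempty) : ∃ q ∈ coneOver (interior P), IsGeneric w q := by
  obtain ⟨u, hu⟩ := hP
  obtain ⟨r, hr⟩ := exists_isGeneric w
  have hu' : ((u, 1) : F × ℝ) ∈ coneOver (interior P) := ⟨one_pos, by simpa using hu⟩
  obtain ⟨ε, h1, h2⟩ := ((eventually_add_smul_mem_coneOver_interior hu' r).and
    (hr.eventually_add_smul (u, 1))).exists
  exact ⟨_, h1, h2⟩

end PolytopeCone

/-! ### The integer lattice -/

section Lattice

open Module

/-- The integer lattice `ℤ^d × ℤ` inside `ℝ^d × ℝ`. -/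
def latticeProd (d : ℕ) : AddSubgroup ((Fin d → ℝ) × ℝ) :=
  (((Int.castAddHom ℝ).compLeft (Fin d)).prodMap (Int.castAddHom ℝ)).range

lemma mem_latticeProd {d : ℕ} {y : (Fin d → ℝ) × ℝ} :
    y ∈ latticeProd d ↔ y.1 ∈ lattice d ∧ ∃ n : ℤ, y.2 = n := by
  constructor
  · rintro ⟨⟨z, n⟩, rfl⟩
    exact ⟨fun i => ⟨z i, rfl⟩, n, rfl⟩
  · rintro ⟨h, n, hn⟩
    choose z hz using h
    exact ⟨(z, n), Prod.ext (funext fun i => (hz i).symm) hn.symm⟩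

lemma finite_latticeProd_inter_closedBall (d : ℕ) (R : ℝ) :
    (Metric.closedBall 0 R ∩ (latticeProd d : Set ((Fin d → ℝ) × ℝ))).Finite := by
  obtain ⟨N, hN⟩ := exists_nat_ge R
  refine (((Set.finite_Icc (fun _ : Fin d => -(N : ℤ)) fun _ => (N : ℤ)).prod
    (Set.finite_Icc (-(N : ℤ)) N)).image
    (((Int.castAddHom ℝ).compLeft (Fin d)).prodMap (Int.castAddHom ℝ))).subset ?_
  rintro _ ⟨hR, ⟨z, n⟩, rfl⟩
  refine ⟨(z, n), ?_, rfl⟩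
  rw [mem_closedBall_zero_iff] at hR
  replace hR : ‖((fun i => (z i : ℝ), (n : ℝ)) : (Fin d → ℝ) × ℝ)‖ ≤ R := hR
  have key : ∀ m : ℤ, ‖(m : ℝ)‖ ≤ R → -(N : ℤ) ≤ m ∧ m ≤ N := by
    intro m hm
    have h := abs_le.1 ((Real.norm_eq_abs _ ▸ hm).trans hN)
    exact ⟨by exact_mod_cast h.1, by exact_mod_cast h.2⟩
  have hfst : ‖fun i => (z i : ℝ)‖ ≤ R :=
    (norm_fst_le ((fun i => (z i : ℝ), (n : ℝ)) : (Fin d → ℝ) × ℝ)).trans hR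
  have hsnd : ‖(n : ℝ)‖ ≤ R :=
    (norm_snd_le ((fun i => (z i : ℝ), (n : ℝ)) : (Fin d → ℝ) × ℝ)).trans hR
  have hz : ∀ i, -(N : ℤ) ≤ z i ∧ z i ≤ N := fun i =>
    key _ ((norm_le_pi_norm (fun i => (z i : ℝ)) i).trans hfst)
  have hn := key n hsnd
  exact ⟨⟨fun i => (hz i).1, fun i => (hz i).2⟩, hn⟩

lemma finite_basis_box {κ : Type*} [Fintype κ] {d : ℕ} (b : Basis κ ℝ ((Fin d → ℝ) × ℝ)) :
    ({x | ∀ i, 0 ≤ b.repr x i ∧ b.repr x i ≤ 1} ∩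
      (latticeProd d : Set ((Fin d → ℝ) × ℝ))).Finite := by
  refine (finite_latticeProd_inter_closedBall d (∑ i, ‖b i‖)).subset
    (inter_subset_inter_left _ fun x hx => ?_)
  rw [mem_closedBall_zero_iff, ← b.sum_repr x]
  refine norm_sum_le_of_le _ fun i _ => ?_
  rw [norm_smul, Real.norm_of_nonneg (hx i).1]
  exact mul_le_of_le_one_left (norm_nonneg _) (hx i).2

lemma BasisSet.isAdapted {ι : Type*} {d p : ℕ} {w : ι → (Fin d → ℝ) × ℝ}
    (hw : ∀ i, (w i).1 ∈ lattice d) (hwp : ∀ i, (w i).2 = p) (B : BasisSet w) :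
    IsAdapted B.basis (latticeProd d) (LinearMap.snd ℝ _ _) p where
  basis_mem i := mem_latticeProd.2 ⟨by simpa using hw i, p, by simpa using hwp i⟩
  height_int x hx := (mem_latticeProd.1 hx).2
  height_basis i := by simpa using hwp i
  finite_box := finite_basis_box B.basis

lemma BasisSet.card_eq {ι : Type*} {d : ℕ} {w : ι → (Fin d → ℝ) × ℝ} (B : BasisSet w) :
    Fintype.card B.1 = d + 1 := by
  simpa using (finrank_eq_card_basis B.basis).symm

end Lattice

/-- **Ehrhart–Macdonald reciprocity.**  For a rational `d`-polytope `P` with denominator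
`p`, the Ehrhart quasi-polynomial of `P` evaluated at `-t` equals `(-1)^d` times the
number of lattice points in `t·P°`. -/
theorem ehrhart_macdonald_reciprocity
    (d : ℕ) (hd : 1 ≤ d)
    (V : Finset (Fin d → ℝ)) (P : Set (Fin d → ℝ))
    -- `P` is the convex hull of the finite set `V` of rational points
    (hP : P = convexHull ℝ (V : Set (Fin d → ℝ)))
    (hrat : ∀ v ∈ V, ∀ i, ∃ q : ℚ, v i = (q : ℝ))
    -- `V` is exactly the vertex set of `P`
    (hvert : (V : Set (Fin d → ℝ)) = Set.extremePoints ℝ P)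
    -- `P` is full-dimensional
    (hint : (interior P).Nonempty)
    -- `p` is the denominator of `P`
    (p : ℕ) (hp : 0 < p)
    (hpV : ∀ v ∈ V, ∀ i, ∃ n : ℤ, (p : ℝ) * v i = (n : ℝ))
    (hpmin : ∀ q : ℕ, 0 < q → (∀ v ∈ V, ∀ i, ∃ n : ℤ, (q : ℝ) * v i = (n : ℝ)) → p ≤ q) :
    ∃ q : Fin p → Polynomial ℚ,
      ∀ t : ℕ, 1 ≤ t →
        ((((t : ℝ) • P) ∩ lattice d).ncard : ℚ)
            = (q (resMod p hp (t : ℤ))).eval (t : ℚ) ∧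
        (-1 : ℚ) ^ d * (q (resMod p hp (-(t : ℤ)))).eval (-(t : ℚ))
            = ((((t : ℝ) • interior P) ∩ lattice d).ncard : ℚ) := by
  classical
  have hPconv : Convex ℝ P := hP ▸ convex_convexHull ℝ _
  have hPclosed : IsClosed P := by
    rw [hP]
    exact (V.finite_toSet.isCompact_convexHull ℝ).isClosed
  let w : V → (Fin d → ℝ) × ℝ := fun v => ((p : ℝ) • (v : Fin d → ℝ), (p : ℝ))
  have hadapted : ∀ B : BasisSet w, IsAdapted B.basis (latticeProd d) (LinearMap.snd ℝ _ _) p :=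
    BasisSet.isAdapted (fun v i => hpV v v.2 i) fun v => rfl
  have hwpos : ∀ v, 0 < LinearMap.snd ℝ (Fin d → ℝ) ℝ (w v) := fun v => by
    simpa [w] using hp
  obtain ⟨ω, hω⟩ := BasisSet.exists_weights w
  obtain ⟨q, hq, hqgen⟩ := exists_isGeneric_mem_coneOver_interior w hint
  let T := {B : BasisSet w // B.IsRegular ω}
  let J : ∀ B : T, Set B.1.1 := fun B => {i | B.1.basis.repr q i < 0}
  have hslice : ∀ (A : Set (Fin d → ℝ)) (t : ℕ), 1 ≤ t → (((t : ℝ) • A) ∩ lattice d).ncard =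
      {y ∈ coneOver A | y ∈ latticeProd d ∧
        LinearMap.snd ℝ (Fin d → ℝ) ℝ y = t}.ncard := by
    intro A t ht
    rw [← ncard_image_of_injective _ (Prod.mk_left_injective (t : ℝ)),
      image_smul_eq_coneOver_slice A (by exact_mod_cast ht)]
    congr 1
    ext y
    simp only [mem_ofPred_eq, mem_latticeProd, LinearMap.snd_apply]
    refine and_congr_right fun _ => ⟨fun h => ⟨⟨h.1, t, by simpa using h.2⟩, h.2⟩,
      fun h => ⟨h.1.1, h.2⟩⟩
  have hcone : ∀ (x r : (Fin d → ℝ) × ℝ), 0 < x.2 →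
      ((∀ᶠ ε in nhdsWithin (0 : ℝ) (Ioi 0),
        ∃ a : V → ℝ, (∀ i, 0 ≤ a i) ∧ ∑ i, a i • w i = x + ε • r) ↔
      ∀ᶠ ε in nhdsWithin (0 : ℝ) (Ioi 0), x + ε • r ∈ coneOver P) := by
    intro x r hx
    refine Filter.eventually_congr ?_
    filter_upwards [eventually_add_smul_snd_pos hx r] with ε hε
    rw [hP]
    exact exists_nonneg_sum_iff_mem_coneOver V hp hε
  have hcount : ∀ t : ℕ, 1 ≤ t → ((((t : ℝ) • P) ∩ lattice d).ncard : ℚ) =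
      ∑ B : T, ((hadapted B.1).conePoly (J B) d t).eval (t : ℚ) := by
    intro t ht
    have ht' : (0 : ℤ) < t := by exact_mod_cast ht
    rw [hslice P t ht, BasisSet.ncard_eq_sum_shiftedCone _ hwpos hω hqgen,
      finsum_eq_sum_of_fintype, Nat.cast_sum]
    · exact Finset.sum_congr rfl fun B _ => by
        simpa using! (hadapted B.1).ncard_coneSlice hp B.1.card_eq (J B) ht'
    · intro x hx
      have hx' : 0 < x.2 := by
        rw [show x.2 = t from hx]; exact_mod_cast ht
      rw [hcone x q hx', mem_coneOver_iff_eventually hPconv hPclosed hx' hq]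
    · intro B
      simpa using! (hadapted B).finite_coneSlice hp {i | B.basis.repr q i < 0} t
  have hcount' : ∀ t : ℕ, 1 ≤ t → ((((t : ℝ) • interior P) ∩ lattice d).ncard : ℚ) =
      ∑ B : T, ((hadapted B.1).conePoly (J B)ᶜ d t).eval (t : ℚ) := by
    intro t ht
    have ht' : (0 : ℤ) < t := by exact_mod_cast ht
    rw [hslice (interior P) t ht, BasisSet.ncard_eq_sum_shiftedCone _ hwpos hω hqgen.neg,
      finsum_eq_sum_of_fintype, Nat.cast_sum]
    · exact Finset.sum_congr rfl fun B _ => by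
        rw [BasisSet.shiftedCone_neg hqgen]
        simpa using! (hadapted B.1).ncard_coneSlice hp B.1.card_eq (J B)ᶜ ht'
    · intro x hx
      have hx' : 0 < x.2 := by
        rw [show x.2 = t from hx]; exact_mod_cast ht
      rw [hcone x (-q) hx', mem_coneOver_interior_iff_eventually hPconv hq]
    · intro B
      rw [BasisSet.shiftedCone_neg hqgen]
      simpa using! (hadapted B).finite_coneSlice hp {i | B.basis.repr q i < 0}ᶜ t
  have hres : ∀ (B : T) (s : ℤ),
      (hadapted B.1).conePoly (J B) d ((resMod p hp s : ℕ) : ℤ) =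
        (hadapted B.1).conePoly (J B) d s := by
    intro B s
    refine (hadapted B.1).conePoly_congr _ _ ?_
    rw [resMod, Int.toNat_of_nonneg (Int.emod_nonneg s (by exact_mod_cast hp.ne'))]
    exact (Int.mod_modEq s p).symm.dvd
  refine ⟨fun r => ∑ B : T, (hadapted B.1).conePoly (J B) d ((r : ℕ) : ℤ), fun t ht => ⟨?_, ?_⟩⟩
  · simp only [hres, eval_finsetSum]
    exact hcount t ht
  · simp only [hres, eval_finsetSum, Finset.mul_sum]
    rw [hcount' t ht]
    exact Finset.sum_congr rfl fun B _ =>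
      (hadapted B.1).conePoly_reciprocity hp B.1.card_eq (J B) t t

end
end
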